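/- arXiv:1710.01352 — 6 statements merged into one kernel-verified Lean document; each statement's English description precedes it below -/
import Mathlib

section
/- Let n, p ≥ 1, let y_1,…,y_n ∈ {−1,1}, let x_1,…,x_n ∈ ℝ^p (with design matrix X ∈ ℝ^{n×p} whose rows are the x_i^T), let γ > 0, and let ℓ : {−1,1} × ℝ → ℝ be a loss function such that u ↦ ℓ(y,u) is convex for each y ∈ {−1,1}. Then strong duality holds for the regularized classification problem: the infimum over w ∈ ℝ^p, b ∈ ℝ of Σ_{i=1}^n ℓ(y_i, w^T x_i + b) + (1/(2γ))‖w‖₂² equals the supremum over α ∈ ℝ^n with Σ_{i=1}^n α_i = 0 of −Σ_{i=1}^n ℓ̂(y_i, α_i) − (γ/2)‖X^T α‖₂², where both sides are interpreted in the extended reals (the dual objective is −∞ whenever some ℓ̂(y_i, α_i) = +∞). -/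
open scoped BigOperators
open Real

/-- Fenchel conjugate of a loss function in its second argument, valued in the extended reals. -/
noncomputable def fenchelConj (L : ℝ → ℝ → ℝ) (y α : ℝ) : EReal :=
  ⨆ u : ℝ, ((u * α - L y u : ℝ) : EReal)

lemma srd_quad (γ : ℝ) (hγ : 0 < γ) (w q : ℝ) :
    -(w * q) - γ / 2 * q ^ 2 ≤ 1 / (2 * γ) * w ^ 2 := by
  have h : 1 / (2 * γ) * w ^ 2 - (-(w * q) - γ / 2 * q ^ 2) = 1 / (2 * γ) * (w + γ * q) ^ 2 := by
    field_simp
    ring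
  have h2 : 0 ≤ 1 / (2 * γ) * (w + γ * q) ^ 2 := by positivity
  linarith

lemma srd_swap {n p : ℕ} (X : Fin n → Fin p → ℝ) (w : Fin p → ℝ) (b : ℝ) (α : Fin n → ℝ) :
    ∑ i, (∑ j, w j * X i j + b) * α i
      = ∑ j, w j * (∑ i, α i * X i j) + b * ∑ i, α i := by
  simp_rw [add_mul, Finset.sum_add_distrib, Finset.sum_mul, Finset.mul_sum]
  rw [Finset.sum_comm]
  congr 1
  refine Finset.sum_congr rfl fun j _ => Finset.sum_congr rfl fun i _ => by ring

lemma srd_coe_sum {n : ℕ} (f : Fin n → ℝ) :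
    ((∑ i, f i : ℝ) : EReal) = ∑ i, (f i : EReal) :=
  map_sum (⟨⟨fun x : ℝ => (x : EReal), EReal.coe_zero⟩, EReal.coe_add⟩ : ℝ →+ EReal) f Finset.univ

/-- A sum of suprema over separate variables. -/
lemma srd_sum_sup {n : ℕ} (L : ℝ → ℝ → ℝ) (y α : Fin n → ℝ) (M : ℝ)
    (h : ∀ z : Fin n → ℝ, ∑ i, (z i * α i - L (y i) (z i)) ≤ M) :
    ∑ i, fenchelConj L (y i) (α i) ≤ (M : EReal) := by
  have hbdd : ∀ i, BddAbove (Set.range fun u : ℝ => u * α i - L (y i) u) := by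
    intro i
    refine ⟨M - ∑ k ∈ Finset.univ.erase i, (0 * α k - L (y k) 0), ?_⟩
    rintro _ ⟨u, rfl⟩
    have h1 := h (Function.update 0 i u)
    rw [← Finset.add_sum_erase _ _ (Finset.mem_univ i)] at h1
    have h2 : ∑ k ∈ Finset.univ.erase i, (Function.update (0 : Fin n → ℝ) i u k * α k
        - L (y k) (Function.update (0 : Fin n → ℝ) i u k))
        = ∑ k ∈ Finset.univ.erase i, (0 * α k - L (y k) 0) := by
      refine Finset.sum_congr rfl fun k hk => ?_
      rw [Function.update_of_ne (Finset.ne_of_mem_erase hk)]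
      rfl
    rw [h2] at h1
    simp only [Function.update_self] at h1
    show u * α i - L (y i) u ≤ _
    linarith
  set s : Fin n → ℝ := fun i => ⨆ u : ℝ, (u * α i - L (y i) u) with hs
  have hle : ∀ i, fenchelConj L (y i) (α i) ≤ (s i : EReal) := by
    intro i
    refine iSup_le fun u => ?_
    exact EReal.coe_le_coe_iff.2 (le_ciSup (hbdd i) u)
  refine (Finset.sum_le_sum fun i _ => hle i).trans ?_
  rw [← srd_coe_sum, EReal.coe_le_coe_iff]
  refine le_of_forall_pos_le_add fun ε hε => ?_
  have hδ : 0 < ε / (n + 1) := by positivity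
  have hex : ∀ i, ∃ u : ℝ, s i - ε / (n + 1) < u * α i - L (y i) u := fun i =>
    exists_lt_of_lt_ciSup (sub_lt_self _ hδ)
  choose z hz using hex
  have h1 : ∑ i, (s i - ε / (n + 1)) ≤ M :=
    (Finset.sum_le_sum fun i _ => (hz i).le).trans (h z)
  rw [Finset.sum_sub_distrib] at h1
  simp only [Finset.sum_const, Finset.card_univ, Fintype.card_fin, nsmul_eq_mul] at h1
  have h2 : (n : ℝ) * (ε / (n + 1)) ≤ ε := by
    rw [mul_div_assoc', div_le_iff₀ (by positivity)]
    nlinarith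
  linarith

/-- Existence of a dual multiplier. -/
lemma srd_multiplier {n p : ℕ} (l : Fin n → ℝ → ℝ)
    (hl : ∀ i, ConvexOn ℝ Set.univ (l i))
    (X : Fin n → Fin p → ℝ) (c : ℝ) (hc : 0 < c) (P : ℝ)
    (hP : ∀ (w : Fin p → ℝ) (b : ℝ),
      P ≤ ∑ i, l i (∑ j, w j * X i j + b) + c * ∑ j, (w j) ^ 2) :
    ∃ α : Fin n → ℝ, ∀ (w : Fin p → ℝ) (b : ℝ) (u : Fin n → ℝ),
      P + ∑ i, α i * u i
        ≤ ∑ i, l i (∑ j, w j * X i j + b + u i) + c * ∑ j, (w j) ^ 2 := by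
  have hcont : ∀ i, Continuous (l i) := fun i => by
    rw [← continuousOn_univ]
    exact (hl i).continuousOn isOpen_univ
  let F : (Fin p → ℝ) → ℝ → (Fin n → ℝ) → ℝ := fun w b u =>
    ∑ i, l i (∑ j, w j * X i j + b + u i) + c * ∑ j, (w j) ^ 2
  let S : Set ((Fin n → ℝ) × ℝ) := {x | ∃ w b, F w b x.1 < x.2}
  have hSo : IsOpen S := by
    have : S = ⋃ w, ⋃ b, {x | F w b x.1 < x.2} := by
      ext x
      simp [S]
    rw [this]
    refine isOpen_iUnion fun w => isOpen_iUnion fun b => isOpen_lt ?_ continuous_snd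
    refine Continuous.add (continuous_finsetSum _ fun i _ => (hcont i).comp ?_) continuous_const
    fun_prop
  have hSc : Convex ℝ S := by
    rintro ⟨u, t⟩ ⟨w, b, h⟩ ⟨u', t'⟩ ⟨w', b', h'⟩ a a' ha ha' haa
    refine ⟨a • w + a' • w', a * b + a' * b', ?_⟩
    have key : F (a • w + a' • w') (a * b + a' * b') (a • u + a' • u')
        ≤ a * F w b u + a' * F w' b' u' := by
      have h1 : ∀ i, l i (∑ j, (a • w + a' • w') j * X i j + (a * b + a' * b')
            + (a • u + a' • u') i)
          ≤ a * l i (∑ j, w j * X i j + b + u i) + a' * l i (∑ j, w' j * X i j + b' + u' i) := by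
        intro i
        have h2 := (hl i).2 (Set.mem_univ (∑ j, w j * X i j + b + u i))
          (Set.mem_univ (∑ j, w' j * X i j + b' + u' i)) ha ha' haa
        simp only [smul_eq_mul] at h2
        have e : ∑ j, (a • w + a' • w') j * X i j + (a * b + a' * b') + (a • u + a' • u') i
            = a * (∑ j, w j * X i j + b + u i) + a' * (∑ j, w' j * X i j + b' + u' i) := by
          simp only [Pi.add_apply, Pi.smul_apply, smul_eq_mul, add_mul, Finset.sum_add_distrib,
            mul_add, Finset.mul_sum, mul_assoc]
          ring
        rw [e]
        exact h2
      have h3 : ∑ j, ((a • w + a' • w') j) ^ 2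
          ≤ a * ∑ j, (w j) ^ 2 + a' * ∑ j, (w' j) ^ 2 := by
        rw [Finset.mul_sum, Finset.mul_sum, ← Finset.sum_add_distrib]
        refine Finset.sum_le_sum fun j _ => ?_
        simp only [Pi.add_apply, Pi.smul_apply, smul_eq_mul]
        obtain rfl : a' = 1 - a := by linarith
        nlinarith [mul_nonneg (mul_nonneg ha ha') (sq_nonneg (w j - w' j))]
      have h4 := Finset.sum_le_sum fun i (_ : i ∈ Finset.univ) => h1 i
      rw [Finset.sum_add_distrib, ← Finset.mul_sum, ← Finset.mul_sum] at h4
      have h5 := mul_le_mul_of_nonneg_left h3 hc.le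
      simp only [F]
      linarith
    refine lt_of_le_of_lt key ?_
    simp only [Prod.snd_add, Prod.smul_snd, smul_eq_mul]
    simp only at h h'
    rcases ha.eq_or_lt with rfl | ha0
    · obtain rfl : a' = 1 := by linarith
      linarith
    · have := mul_lt_mul_of_pos_left h ha0
      have := mul_le_mul_of_nonneg_left h'.le ha'
      linarith
  have hnot : ((0 : Fin n → ℝ), P) ∉ S := by
    rintro ⟨w, b, h⟩
    have := hP w b
    simp only [F, Pi.zero_apply, add_zero] at h
    linarith
  obtain ⟨f, hf⟩ := geometric_hahn_banach_point_open hSc hSo hnot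
  let k : ℝ := f (0, 1)
  have hdec : ∀ u t, f (u, t) = f (u, 0) + t * k := by
    intro u t
    have : (u, t) = (u, (0 : ℝ)) + t • ((0 : Fin n → ℝ), (1 : ℝ)) := by simp
    rw [this, map_add, map_smul]
    rfl
  have h0 : f ((0 : Fin n → ℝ), (0 : ℝ)) = 0 := map_zero f
  have hk : 0 < k := by
    have h1 := hf (0, F 0 0 0 + 1) ⟨0, 0, by simp⟩
    rw [hdec, hdec 0 (_ + _), h0] at h1
    have h2 : P ≤ F 0 0 0 := by
      have := hP 0 0
      simpa [F] using this
    by_contra hk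
    push Not at hk
    nlinarith
  have hg : ∀ u : Fin n → ℝ, f (u, 0) = ∑ i, u i * f (Pi.single i 1, 0) := by
    intro u
    have : f (u, 0) = (f.toLinearMap.comp (LinearMap.inl ℝ (Fin n → ℝ) ℝ)) u := rfl
    rw [this, LinearMap.pi_apply_eq_sum_univ]
    refine Finset.sum_congr rfl fun i _ => ?_
    simp only [smul_eq_mul]
    congr 1
    show f (_, 0) = _
    congr 2
    ext j
    simp [Pi.single_apply, eq_comm]
  refine ⟨fun i => -(f (Pi.single i 1, 0)) / k, fun w b u => ?_⟩
  have hsum : ∑ i, -(f (Pi.single i 1, 0)) / k * u i = -(f (u, 0)) / k := by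
    rw [hg, ← Finset.sum_neg_distrib, Finset.sum_div]
    refine Finset.sum_congr rfl fun i _ => by ring
  rw [hsum]
  refine le_of_forall_pos_le_add fun ε hε => ?_
  have h1 := hf (u, F w b u + ε) ⟨w, b, by simpa using hε⟩
  rw [hdec, hdec u (_ + _), h0] at h1
  show P + _ ≤ F w b u + ε
  have : (P + -(f (u, 0)) / k) * k ≤ (F w b u + ε) * k := by
    rw [add_mul, div_mul_cancel₀ _ hk.ne']
    linarith
  exact le_of_mul_le_mul_right this hk

/-- Strong duality for regularized classification. -/
theorem strong_duality_regularized_classification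
    (n p : ℕ) (hn : 1 ≤ n) (hp : 1 ≤ p)
    (y : Fin n → ℝ) (hy : ∀ i, y i = 1 ∨ y i = -1)
    (X : Fin n → Fin p → ℝ) (γ : ℝ) (hγ : 0 < γ)
    (L : ℝ → ℝ → ℝ)
    (hconv : ∀ z : ℝ, z = 1 ∨ z = -1 → ConvexOn ℝ Set.univ (fun u => L z u)) :
    (⨅ (w : Fin p → ℝ) (b : ℝ),
        ((∑ i, L (y i) (∑ j, w j * X i j + b)
          + (1 / (2 * γ)) * ∑ j, (w j) ^ 2 : ℝ) : EReal))
      = ⨆ (α : Fin n → ℝ) (_ : ∑ i, α i = 0),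
          (-(∑ i, fenchelConj L (y i) (α i))
            - (((γ / 2) * ∑ j, (∑ i, α i * X i j) ^ 2 : ℝ) : EReal)) := by
  apply le_antisymm
  · by_cases hbot : (⨅ (w : Fin p → ℝ) (b : ℝ),
        ((∑ i, L (y i) (∑ j, w j * X i j + b)
          + (1 / (2 * γ)) * ∑ j, (w j) ^ 2 : ℝ) : EReal)) = ⊥
    · rw [hbot]
      exact bot_le
    have hlow := fun (w : Fin p → ℝ) (b : ℝ) => iInf₂_le (f := fun (w : Fin p → ℝ) (b : ℝ) =>
        ((∑ i, L (y i) (∑ j, w j * X i j + b)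
          + (1 / (2 * γ)) * ∑ j, (w j) ^ 2 : ℝ) : EReal)) w b
    revert hbot hlow
    generalize (⨅ (w : Fin p → ℝ) (b : ℝ),
        ((∑ i, L (y i) (∑ j, w j * X i j + b)
          + (1 / (2 * γ)) * ∑ j, (w j) ^ 2 : ℝ) : EReal)) = P
    intro hbot hlow
    induction P with
    | bot => exact absurd rfl hbot
    | top => exact absurd (hlow 0 0) (not_le.2 (EReal.coe_lt_top _))
    | coe P =>
      obtain ⟨α, hα⟩ := srd_multiplier (fun i => L (y i)) (fun i => hconv _ (hy i)) X
        (1 / (2 * γ)) (by positivity) P (fun w b => EReal.coe_le_coe_iff.1 (hlow w b))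
      have key : ∀ (w : Fin p → ℝ) (b : ℝ) (z : Fin n → ℝ),
          P + ∑ i, (z i * α i - L (y i) (z i)) ≤ ∑ j, w j * (∑ i, α i * X i j) + b * ∑ i, α i
            + (1 / (2 * γ)) * ∑ j, (w j) ^ 2 := by
        intro w b z
        have h := hα w b (fun i => z i - (∑ j, w j * X i j + b))
        simp only [add_sub_cancel, mul_sub, Finset.sum_sub_distrib] at h
        rw [← srd_swap, Finset.sum_sub_distrib]
        simp only [mul_comm _ (α _)]
        linarith
      have hsum : ∑ i, α i = 0 := by
        by_contra hne
        have h := key 0 ((P + ∑ i, ((0 : Fin n → ℝ) i * α i - L (y i) ((0 : Fin n → ℝ) i)) - 1)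
          / ∑ i, α i) 0
        rw [div_mul_cancel₀ _ hne] at h
        simp at h
        linarith
      refine le_iSup₂_of_le α hsum ?_
      have hle := srd_sum_sup L y α (-P - γ / 2 * ∑ j, (∑ i, α i * X i j) ^ 2) (by
        intro z
        have h := key (fun j => -γ * ∑ i, α i * X i j) 0 z
        have e : ∑ j, (-γ * ∑ i, α i * X i j) * (∑ i, α i * X i j)
            + (1 / (2 * γ)) * ∑ j, (-γ * ∑ i, α i * X i j) ^ 2
            = -(γ / 2 * ∑ j, (∑ i, α i * X i j) ^ 2) := by
          rw [Finset.mul_sum, Finset.mul_sum, ← Finset.sum_add_distrib, ← Finset.sum_neg_distrib]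
          refine Finset.sum_congr rfl fun j _ => ?_
          field_simp
          ring
        linarith)
      refine le_trans ?_ (EReal.sub_le_sub (EReal.neg_le_neg_iff.2 hle) le_rfl)
      rw [← EReal.coe_neg, ← EReal.coe_sub, EReal.coe_le_coe_iff]
      linarith
  · refine iSup₂_le fun α hα => le_iInf₂ fun w b => ?_
    have h1 : ((∑ i, ((∑ j, w j * X i j + b) * α i - L (y i) (∑ j, w j * X i j + b)) : ℝ) : EReal)
        ≤ ∑ i, fenchelConj L (y i) (α i) := by
      rw [srd_coe_sum]
      exact Finset.sum_le_sum fun i _ => le_iSup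
        (fun u : ℝ => ((u * α i - L (y i) u : ℝ) : EReal)) (∑ j, w j * X i j + b)
    refine le_trans (EReal.sub_le_sub (EReal.neg_le_neg_iff.2 h1) le_rfl) ?_
    rw [← EReal.coe_neg, ← EReal.coe_sub, EReal.coe_le_coe_iff, Finset.sum_sub_distrib,
      srd_swap, hα]
    have h2 := Finset.sum_le_sum fun j (_ : j ∈ Finset.univ) =>
      srd_quad γ hγ (w j) (∑ i, α i * X i j)
    rw [Finset.sum_sub_distrib, Finset.sum_neg_distrib, ← Finset.mul_sum, ← Finset.mul_sum] at h2
    linarith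
end

section
/- Let n, p ≥ 1, k ∈ {1,…,p}, let y_1,…,y_n ∈ {−1,1}, let x_1,…,x_n ∈ ℝ^p with design matrix X ∈ ℝ^{n×p} and columns X_1,…,X_p ∈ ℝ^n, let γ > 0, and let ℓ : {−1,1} × ℝ → ℝ be a loss function such that u ↦ ℓ(y,u) is convex for each y. Then the infimum over w ∈ ℝ^p, b ∈ ℝ with ‖w‖₀ ≤ k of Σ_{i=1}^n ℓ(y_i, w^T x_i + b) + (1/(2γ))‖w‖₂² equals the minimum over binary vectors s ∈ {0,1}^p with Σ_j s_j ≤ k of c(s), where c(s) := sup over α ∈ ℝ^n with Σ_i α_i = 0 of −Σ_{i=1}^n ℓ̂(y_i, α_i) − (γ/2) Σ_{j=1}^p s_j (X_j^T α)², both sides interpreted in the extended reals. -/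
open scoped BigOperators
open Real

/-- Abstract Fenchel strong duality via separation. -/
lemma duality_aux {n : ℕ} {E : Type*} [AddCommGroup E] [Module ℝ E]
    (F : (Fin n → ℝ) → ℝ) (hF : ConvexOn ℝ Set.univ F) (hFc : Continuous F)
    (Q : E → ℝ) (hQ : ConvexOn ℝ Set.univ Q) (A : E →ₗ[ℝ] (Fin n → ℝ)) (m : ℝ)
    (hm : ∀ e, m ≤ F (A e) + Q e) :
    ∃ a : Fin n → ℝ, ∀ u e, ∑ i, a i * u i - ∑ i, a i * A e i - F u - Q e ≤ -m := by
  let C : Set ((Fin n → ℝ) × ℝ) := {q | ∃ e, F (A e + q.1) + Q e < q.2}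
  have hCo : IsOpen C := by
    have : C = ⋃ e, {q : (Fin n → ℝ) × ℝ | F (A e + q.1) + Q e < q.2} := by
      ext q; simp [C]
    rw [this]
    refine isOpen_iUnion fun e => isOpen_lt ?_ continuous_snd
    fun_prop
  have hCc : Convex ℝ C := by
    rintro ⟨z, t⟩ ⟨e, he⟩ ⟨z', t'⟩ ⟨e', he'⟩ a b ha hb hab
    refine ⟨a • e + b • e', ?_⟩
    have h1 := hF.2 (Set.mem_univ (A e + z)) (Set.mem_univ (A e' + z')) ha hb hab
    have h2 := hQ.2 (Set.mem_univ e) (Set.mem_univ e') ha hb hab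
    have h3 : A (a • e + b • e') + (a • (z, t) + b • (z', t')).1
        = a • (A e + z) + b • (A e' + z') := by
      simp only [map_add, map_smul, Prod.fst_add, Prod.smul_fst, smul_add]
      abel
    rw [h3]
    simp only [Prod.snd_add, Prod.smul_snd, smul_eq_mul] at *
    rcases ha.eq_or_lt with h0 | h0
    · subst h0
      have : b = 1 := by linarith
      subst this
      linarith
    · nlinarith [mul_lt_mul_of_pos_left he h0, mul_le_mul_of_nonneg_left he'.le hb]
  have hnot : ((0 : Fin n → ℝ), m) ∉ C := by
    rintro ⟨e, he⟩
    have := hm e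
    simp only [add_zero] at he
    linarith
  obtain ⟨f, hf⟩ := geometric_hahn_banach_open_point hCc hCo hnot
  let β := f (0, 1)
  have hdec : ∀ z t, f (z, t) = ∑ i, z i * f (Pi.single i 1, 0) + t * β := by
    intro z t
    have h1 : (z, t) = (z, (0:ℝ)) + t • ((0 : Fin n → ℝ), (1:ℝ)) := by simp
    have h2 : f (z, 0) = ∑ i, z i * f (Pi.single i 1, 0) := by
      have h := LinearMap.pi_apply_eq_sum_univ
        ((f : ((Fin n → ℝ) × ℝ) →ₗ[ℝ] ℝ).comp (LinearMap.inl ℝ (Fin n → ℝ) ℝ)) z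
      simp only [LinearMap.comp_apply, LinearMap.inl_apply, smul_eq_mul] at h
      refine h.trans (Finset.sum_congr rfl fun i _ => ?_)
      have h4 : (fun j => if i = j then (1 : ℝ) else 0) = Pi.single i 1 := by
        ext j
        simp [Pi.single_apply, eq_comm]
      rw [h4]
      rfl
    rw [h1, map_add, map_smul, h2, smul_eq_mul]
  have hβ : β < 0 := by
    have h := hf (0, F (A 0) + Q 0 + 1) ⟨0, by simp⟩
    rw [hdec, hdec] at h
    have := hm 0
    simp only [Pi.zero_apply, zero_mul, Finset.sum_const_zero, zero_add] at h
    by_contra hc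
    push Not at hc
    nlinarith
  refine ⟨fun i => f (Pi.single i 1, 0) / (-β), fun u e => ?_⟩
  refine le_of_forall_pos_le_add fun ε hε => ?_
  have h := hf (u - A e, F u + Q e + ε) ⟨e, by simp [hε]⟩
  rw [hdec, hdec] at h
  simp only [Pi.zero_apply, zero_mul, Finset.sum_const_zero, zero_add, Pi.sub_apply, sub_mul,
    Finset.sum_sub_distrib] at h
  have e1 : ∀ v : Fin n → ℝ, ∑ i, f (Pi.single i 1, 0) / (-β) * v i
      = (∑ i, v i * f (Pi.single i 1, 0)) / (-β) := by
    intro v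
    rw [Finset.sum_div]
    exact Finset.sum_congr rfl fun i _ => by ring
  rw [e1, e1, ← sub_div]
  have hb : 0 < -β := by linarith
  have : (∑ i, u i * f (Pi.single i 1, 0) - ∑ i, A e i * f (Pi.single i 1, 0)) / (-β)
      ≤ F u + Q e + ε - m := by
    rw [div_le_iff₀ hb]
    nlinarith
  linarith

lemma fenchel_sum_le {n : ℕ} (L : ℝ → ℝ → ℝ) (y a : Fin n → ℝ) (K : ℝ)
    (h : ∀ u : Fin n → ℝ, ∑ i, (u i * a i - L (y i) (u i)) ≤ K) :
    ∑ i, fenchelConj L (y i) (a i) ≤ (K : EReal) := by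
  let g : Fin n → ℝ → ℝ := fun i u => u * a i - L (y i) u
  have hbdd : ∀ i, BddAbove (Set.range (g i)) := by
    intro i
    refine ⟨K - ∑ j ∈ Finset.univ.erase i, g j 0, ?_⟩
    rintro _ ⟨u, rfl⟩
    have h1 := h (Function.update 0 i u)
    rw [← Finset.add_sum_erase _ _ (Finset.mem_univ i)] at h1
    have h2 : ∑ j ∈ Finset.univ.erase i, (Function.update (0 : Fin n → ℝ) i u j * a j
        - L (y j) (Function.update (0 : Fin n → ℝ) i u j))
        = ∑ j ∈ Finset.univ.erase i, g j 0 := by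
      refine Finset.sum_congr rfl fun j hj => ?_
      rw [Function.update_of_ne (Finset.ne_of_mem_erase hj)]
      rfl
    rw [h2, Function.update_self] at h1
    change u * a i - L (y i) u ≤ _
    linarith
  have h1 : ∀ i, fenchelConj L (y i) (a i) ≤ ((⨆ u, g i u : ℝ) : EReal) := fun i =>
    iSup_le fun u => EReal.coe_le_coe_iff.2 (le_ciSup (hbdd i) u)
  refine (Finset.sum_le_sum fun i _ => h1 i).trans ?_
  have hc : ∀ v : Fin n → ℝ, ∑ i, ((v i : ℝ) : EReal) = ((∑ i, v i : ℝ) : EReal) := fun v =>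
    (map_sum (⟨⟨Real.toEReal, rfl⟩, EReal.coe_add⟩ : ℝ →+ EReal) v Finset.univ).symm
  rw [hc, EReal.coe_le_coe_iff]
  refine le_of_forall_pos_le_add fun ε hε => ?_
  have hδ : 0 < ε / (n + 1) := by positivity
  have h2 : ∀ i, ∃ u, (⨆ u, g i u) - ε / (n + 1) < g i u := fun i =>
    exists_lt_of_lt_ciSup (by linarith)
  choose u hu using h2
  have h3 := h u
  have h4 : ∑ i, ((⨆ u, g i u) - ε / (n + 1)) ≤ ∑ i, g i (u i) :=
    Finset.sum_le_sum fun i _ => (hu i).le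
  rw [Finset.sum_sub_distrib] at h4
  simp only [Finset.sum_const, Finset.card_univ, Fintype.card_fin, nsmul_eq_mul] at h4
  have h5 : (n : ℝ) * (ε / (n + 1)) ≤ ε := by
    rw [mul_div_assoc', div_le_iff₀ (by positivity)]
    nlinarith
  change ∑ i, g i (u i) ≤ K at h3
  linarith

lemma le_fenchel_sum {n : ℕ} (L : ℝ → ℝ → ℝ) (y a u : Fin n → ℝ) :
    ((∑ i, (u i * a i - L (y i) (u i)) : ℝ) : EReal) ≤ ∑ i, fenchelConj L (y i) (a i) := by
  have hc : ∀ v : Fin n → ℝ, ∑ i, ((v i : ℝ) : EReal) = ((∑ i, v i : ℝ) : EReal) := fun v =>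
    (map_sum (⟨⟨Real.toEReal, rfl⟩, EReal.coe_add⟩ : ℝ →+ EReal) v Finset.univ).symm
  rw [← hc]
  exact Finset.sum_le_sum fun i _ =>
    le_iSup (fun u : ℝ => ((u * a i - L (y i) u : ℝ) : EReal)) (u i)

/-- The sparse regularized classification problem equals the binary convex optimization
problem `min_{s ∈ S_k^p} c(s)`. -/
theorem sparse_classification_binary_convex_reformulation
    (n p k : ℕ) (hn : 1 ≤ n) (hp : 1 ≤ p) (hk : 1 ≤ k) (hkp : k ≤ p)
    (y : Fin n → ℝ) (hy : ∀ i, y i = 1 ∨ y i = -1)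
    (X : Fin n → Fin p → ℝ) (γ : ℝ) (hγ : 0 < γ)
    (L : ℝ → ℝ → ℝ)
    (hconv : ∀ z : ℝ, z = 1 ∨ z = -1 → ConvexOn ℝ Set.univ (fun u => L z u)) :
    (⨅ (w : Fin p → ℝ) (_ : (Finset.univ.filter fun j => w j ≠ 0).card ≤ k) (b : ℝ),
        ((∑ i, L (y i) (∑ j, w j * X i j + b)
          + (1 / (2 * γ)) * ∑ j, (w j) ^ 2 : ℝ) : EReal))
      = ⨅ (s : Fin p → ℝ) (_ : ∀ j, s j = 0 ∨ s j = 1) (_ : ∑ j, s j ≤ (k : ℝ)),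
          ⨆ (α : Fin n → ℝ) (_ : ∑ i, α i = 0),
            (-(∑ i, fenchelConj L (y i) (α i))
              - (((γ / 2) * ∑ j, s j * (∑ i, α i * X i j) ^ 2 : ℝ) : EReal)) := by
  have hswap : ∀ (α : Fin n → ℝ) (w : Fin p → ℝ) (b : ℝ), ∑ i, α i = 0 →
      ∑ i, α i * (∑ j, w j * X i j + b) = ∑ j, w j * ∑ i, α i * X i j := by
    intro α w b hα
    simp only [mul_add, Finset.sum_add_distrib, ← Finset.sum_mul, hα, zero_mul, add_zero,
      Finset.mul_sum]
    rw [Finset.sum_comm]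
    exact Finset.sum_congr rfl fun j _ => Finset.sum_congr rfl fun i _ => by ring
  apply le_antisymm
  · refine le_iInf fun s => le_iInf fun hs => le_iInf fun hsk => ?_
    rw [← EReal.ge_of_forall_gt_iff_ge]
    intro m hm
    -- primal lower bound on the support of s
    have hcard : ∀ v : Fin p → ℝ,
        (Finset.univ.filter fun j => s j * v j ≠ 0).card ≤ k := by
      intro v
      have h1 : (((Finset.univ.filter fun j => s j * v j ≠ 0).card : ℕ) : ℝ) ≤ ∑ j, s j := by
        rw [Finset.card_filter]
        push_cast
        refine Finset.sum_le_sum fun j _ => ?_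
        rcases hs j with h | h <;> simp [h]
        split_ifs <;> norm_num
      exact_mod_cast h1.trans hsk
    have hlow : ∀ (v : Fin p → ℝ) (b : ℝ),
        m ≤ ∑ i, L (y i) (∑ j, s j * v j * X i j + b)
          + (1 / (2 * γ)) * ∑ j, (s j * v j) ^ 2 := by
      intro v b
      have h1 := hm.le.trans (iInf_le_of_le (fun j => s j * v j)
        (iInf_le_of_le (hcard v) (iInf_le _ b)))
      exact EReal.coe_le_coe_iff.1 h1
    let F : (Fin n → ℝ) → ℝ := fun u => ∑ i, L (y i) (u i)
    let Q : (Fin p → ℝ) × ℝ → ℝ := fun e => (1 / (2 * γ)) * ∑ j, (s j * e.1 j) ^ 2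
    let A : (Fin p → ℝ) × ℝ →ₗ[ℝ] (Fin n → ℝ) :=
      { toFun := fun e i => ∑ j, s j * e.1 j * X i j + e.2
        map_add' := by
          intro e e'
          ext i
          simp only [Prod.fst_add, Prod.snd_add, Pi.add_apply, mul_add, add_mul,
            Finset.sum_add_distrib]
          ring
        map_smul' := by
          intro c e
          ext i
          simp only [Prod.smul_fst, Prod.smul_snd, Pi.smul_apply, smul_eq_mul, RingHom.id_apply,
            mul_add, Finset.mul_sum]
          congr 1
          exact Finset.sum_congr rfl fun j _ => by ring }
    have hF : ConvexOn ℝ Set.univ F := by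
      refine ⟨convex_univ, fun u _ v _ a b ha hb hab => ?_⟩
      simp only [F, smul_eq_mul, Finset.mul_sum, ← Finset.sum_add_distrib]
      refine Finset.sum_le_sum fun i _ => ?_
      exact (hconv (y i) (hy i)).2 (Set.mem_univ (u i)) (Set.mem_univ (v i)) ha hb hab
    have hFc : Continuous F := by
      rw [← continuousOn_univ]
      exact hF.continuousOn isOpen_univ
    have hQ : ConvexOn ℝ Set.univ Q := by
      refine ⟨convex_univ, fun u _ v _ a b ha hb hab => ?_⟩
      have h1 : ∑ j, (s j * (a • u + b • v).1 j) ^ 2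
          ≤ a * ∑ j, (s j * u.1 j) ^ 2 + b * ∑ j, (s j * v.1 j) ^ 2 := by
        rw [Finset.mul_sum, Finset.mul_sum, ← Finset.sum_add_distrib]
        refine Finset.sum_le_sum fun j _ => ?_
        simp only [Prod.fst_add, Prod.smul_fst, Pi.add_apply, Pi.smul_apply, smul_eq_mul]
        have hb' : b = 1 - a := by linarith
        subst hb'
        nlinarith [mul_nonneg (mul_nonneg ha hb) (sq_nonneg (s j * u.1 j - s j * v.1 j))]
      have h2 : 0 ≤ 1 / (2 * γ) := by positivity
      have h3 := mul_le_mul_of_nonneg_left h1 h2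
      simp only [Q, smul_eq_mul]
      linarith
    obtain ⟨a, ha⟩ := duality_aux F hF hFc Q hQ A m (fun e => hlow e.1 e.2)
    have hsum : ∑ i, a i = 0 := by
      by_contra hne
      have h1 := ha 0 (0, (-m - (-F 0) + 1) / (-∑ i, a i))
      simp only [A, Q, LinearMap.coe_mk, AddHom.coe_mk, Pi.zero_apply, mul_zero, zero_mul,
        Finset.sum_const_zero, zero_add, ← Finset.sum_mul] at h1
      have h2 : (∑ i, a i) * ((-m - (-F 0) + 1) / (-∑ i, a i)) = -(-m - (-F 0) + 1) := by
        field_simp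
      rw [h2] at h1
      norm_num at h1
      linarith
    refine le_iSup_of_le a (le_iSup_of_le hsum ?_)
    set D : ℝ := (γ / 2) * ∑ j, s j * (∑ i, a i * X i j) ^ 2 with hD
    have hK : ∑ i, fenchelConj L (y i) (a i) ≤ ((-m - D : ℝ) : EReal) := by
      refine fenchel_sum_le L y a _ fun u => ?_
      have h1 := ha u (fun j => -γ * ∑ i, a i * X i j, 0)
      have h2 := hswap a (fun j => s j * (-γ * ∑ i, a i * X i j)) 0 hsum
      simp only [A, Q, F, LinearMap.coe_mk, AddHom.coe_mk] at h1
      rw [h2] at h1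
      have h3 : ∑ j, s j * (-γ * ∑ i, a i * X i j) * ∑ i, a i * X i j = -(2 * D) := by
        rw [hD, Finset.mul_sum, Finset.mul_sum, ← Finset.sum_neg_distrib]
        exact Finset.sum_congr rfl fun j _ => by ring
      have h4 : (1 / (2 * γ)) * ∑ j, (s j * (-γ * ∑ i, a i * X i j)) ^ 2 = D := by
        rw [hD, Finset.mul_sum, Finset.mul_sum]
        refine Finset.sum_congr rfl fun j _ => ?_
        rcases hs j with h | h <;> rw [h]
        · simp
        · field_simp
      rw [h3, h4] at h1
      rw [Finset.sum_sub_distrib]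
      have h5 : ∑ i, u i * a i = ∑ i, a i * u i := Finset.sum_congr rfl fun i _ => mul_comm _ _
      linarith
    have h6 := EReal.sub_le_sub (EReal.neg_le_neg_iff.2 hK) (le_refl (D : EReal))
    refine le_trans (le_of_eq ?_) h6
    rw [← EReal.coe_neg, ← EReal.coe_sub]
    congr 1
    ring
  · refine le_iInf fun w => le_iInf fun hw => le_iInf fun b => ?_
    refine iInf_le_of_le (fun j => if w j ≠ 0 then 1 else 0) (iInf_le_of_le ?_
      (iInf_le_of_le ?_ ?_))
    · intro j
      by_cases h : w j = 0 <;> simp [h]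
    · rw [Finset.sum_boole]
      exact_mod_cast hw
    refine iSup_le fun α => iSup_le fun hα => ?_
    have h1 := le_fenchel_sum L y α (fun i => ∑ j, w j * X i j + b)
    have h2 := EReal.sub_le_sub (EReal.neg_le_neg_iff.2 h1)
      (le_refl ((((γ / 2) * ∑ j, (if w j ≠ 0 then 1 else 0) * (∑ i, α i * X i j) ^ 2 : ℝ)) : EReal))
    refine h2.trans ?_
    rw [← EReal.coe_neg, ← EReal.coe_sub, EReal.coe_le_coe_iff, Finset.sum_sub_distrib]
    have h3 := hswap α w b hα
    have h4 : ∑ i, (∑ j, w j * X i j + b) * α i = ∑ j, w j * ∑ i, α i * X i j := by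
      rw [← h3]
      exact Finset.sum_congr rfl fun i _ => mul_comm _ _
    rw [h4]
    have h5 : 0 ≤ ∑ j, (w j * (∑ i, α i * X i j)
        + γ / 2 * ((if w j ≠ 0 then 1 else 0) * (∑ i, α i * X i j) ^ 2)
        + 1 / (2 * γ) * (w j) ^ 2) := by
      refine Finset.sum_nonneg fun j _ => ?_
      by_cases h : w j = 0
      · simp [h]
      · simp only [ne_eq, h, not_false_eq_true, if_true, one_mul]
        have : w j * (∑ i, α i * X i j) + γ / 2 * (∑ i, α i * X i j) ^ 2
            + 1 / (2 * γ) * (w j) ^ 2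
            = 1 / (2 * γ) * (w j + γ * ∑ i, α i * X i j) ^ 2 := by
          field_simp
          ring
        rw [this]
        positivity
    rw [Finset.sum_add_distrib, Finset.sum_add_distrib, ← Finset.mul_sum, ← Finset.mul_sum] at h5
    linarith
end

section
/- For every y ∈ {−1,1} and α ∈ ℝ, the Fenchel conjugate of the logistic loss ℓ(y,u) = log(1 + e^{−yu}) satisfies: if yα ∈ [−1,0] then sup_{u ∈ ℝ} (uα − log(1 + e^{−yu})) = (1 + yα) log(1 + yα) − yα log(−yα) (with the convention 0·log 0 = 0), and if yα ∉ [−1,0] then sup_{u ∈ ℝ} (uα − log(1 + e^{−yu})) = +∞. -/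
open Real

lemma aux_log {b p : ℝ} (hb : 0 ≤ b) (hp : 0 < p) :
    b * (Real.log p - Real.log b) ≤ p - b := by
  rcases hb.eq_or_lt with h | h
  · subst h; simpa using hp.le
  · have h1 := Real.log_le_sub_one_of_pos (div_pos hp h)
    rw [Real.log_div hp.ne' h.ne'] at h1
    calc b * (Real.log p - Real.log b) ≤ b * (p / b - 1) := by gcongr
      _ = p - b := by field_simp

lemma aux_upper {b : ℝ} (h0 : 0 ≤ b) (h1 : b ≤ 1) (w : ℝ) :
    w * b - Real.log (1 + Real.exp w) ≤ (1 - b) * Real.log (1 - b) + b * Real.log b := by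
  have hS : 0 < 1 + Real.exp w := by positivity
  have a1 := aux_log h0 (div_pos (Real.exp_pos w) hS)
  have a2 := aux_log (sub_nonneg.2 h1) (div_pos one_pos hS)
  rw [Real.log_div (Real.exp_pos w).ne' hS.ne', Real.log_exp] at a1
  rw [Real.log_div one_ne_zero hS.ne', Real.log_one] at a2
  have a3 : Real.exp w / (1 + Real.exp w) + 1 / (1 + Real.exp w) = 1 := by
    field_simp; ring
  nlinarith

lemma aux_lower {b : ℝ} (h0 : 0 ≤ b) (h1 : b ≤ 1) (c : ℝ)
    (hc : c < (1 - b) * Real.log (1 - b) + b * Real.log b) :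
    ∃ w : ℝ, c < w * b - Real.log (1 + Real.exp w) := by
  rcases h0.eq_or_lt with h | h
  · subst h
    simp at hc
    refine ⟨Real.log (-c / 2), ?_⟩
    rw [Real.exp_log (by linarith)]
    have := Real.log_le_sub_one_of_pos (show 0 < 1 + -c / 2 by linarith)
    linarith
  rcases h1.eq_or_lt with h' | h'
  · subst h'
    simp at hc
    refine ⟨-Real.log (-c / 2), ?_⟩
    have hd : 0 < -c / 2 := by linarith
    rw [Real.exp_neg, Real.exp_log hd]
    have e : 1 + (-c / 2)⁻¹ = (1 + -c / 2) / (-c / 2) := by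
      rw [add_div, div_self hd.ne', one_div, add_comm]
    have := Real.log_le_sub_one_of_pos (show 0 < 1 + -c / 2 by linarith)
    rw [e, Real.log_div (by linarith) hd.ne']
    linarith
  · have hd : 0 < 1 - b := by linarith
    refine ⟨Real.log (b / (1 - b)), ?_⟩
    rw [Real.exp_log (div_pos h hd)]
    have e : 1 + b / (1 - b) = 1 / (1 - b) := by field_simp; ring
    rw [e, Real.log_div h.ne' hd.ne', Real.log_div one_ne_zero hd.ne', Real.log_one]
    linarith

lemma aux_top {b : ℝ} (hb : b < 0 ∨ 1 < b) (c : ℝ) :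
    ∃ w : ℝ, c < w * b - Real.log (1 + Real.exp w) := by
  rcases hb with h | h
  · refine ⟨(|c| + 2) / b, ?_⟩
    have hw : (|c| + 2) / b ≤ 0 := div_nonpos_of_nonneg_of_nonpos (by positivity) h.le
    have he := Real.exp_le_one_iff.2 hw
    have := Real.log_le_sub_one_of_pos
      (show 0 < 1 + Real.exp ((|c| + 2) / b) by positivity)
    rw [div_mul_cancel₀ _ h.ne]
    linarith [le_abs_self c]
  · have hd : 0 < b - 1 := by linarith
    refine ⟨(|c| + 2) / (b - 1), ?_⟩
    set w := (|c| + 2) / (b - 1) with hwdef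
    have hw : 0 ≤ w := by positivity
    have e : 1 + Real.exp w = Real.exp w * (1 + Real.exp (-w)) := by
      rw [mul_add, ← Real.exp_add]; simp [add_comm]
    have he := Real.exp_le_one_iff.2 (neg_nonpos.2 hw)
    have := Real.log_le_sub_one_of_pos (show 0 < 1 + Real.exp (-w) by positivity)
    rw [e, Real.log_mul (Real.exp_pos w).ne' (by positivity), Real.log_exp]
    have : w * (b - 1) = |c| + 2 := div_mul_cancel₀ _ hd.ne'
    linarith [le_abs_self c]

/-- Fenchel conjugate of the logistic loss `ℓ(y,u) = log(1 + exp(-yu))`. -/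
theorem fenchel_conjugate_logistic_loss
    (y α : ℝ) (hy : y = 1 ∨ y = -1) :
    (y * α ∈ Set.Icc (-1 : ℝ) 0 →
      (⨆ u : ℝ, ((u * α - Real.log (1 + Real.exp (-(y * u))) : ℝ) : EReal))
        = (((1 + y * α) * Real.log (1 + y * α) - y * α * Real.log (-(y * α)) : ℝ) : EReal))
    ∧ (y * α ∉ Set.Icc (-1 : ℝ) 0 →
      (⨆ u : ℝ, ((u * α - Real.log (1 + Real.exp (-(y * u))) : ℝ) : EReal)) = ⊤) := by
  have hyy : y * y = 1 := by rcases hy with h | h <;> simp [h]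
  have key : ∀ w : ℝ, (-(y * w)) * α - Real.log (1 + Real.exp (-(y * (-(y * w)))))
      = w * (-(y * α)) - Real.log (1 + Real.exp w) := by
    intro w
    have e : -(y * (-(y * w))) = w := by linear_combination w * hyy
    rw [e]; ring
  refine ⟨fun h => ?_, fun h => ?_⟩
  · obtain ⟨h1, h2⟩ := h
    have hb0 : 0 ≤ -(y * α) := by linarith
    have hb1 : -(y * α) ≤ 1 := by linarith
    have hv : (1 + y * α) * Real.log (1 + y * α) - y * α * Real.log (-(y * α))
        = (1 - -(y * α)) * Real.log (1 - -(y * α)) + -(y * α) * Real.log (-(y * α)) := by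
      rw [sub_neg_eq_add]; ring
    rw [hv]
    apply le_antisymm
    · refine iSup_le fun u => EReal.coe_le_coe_iff.2 ?_
      have k := key (-(y * u))
      have e : -(y * (-(y * u))) = u := by linear_combination u * hyy
      rw [e] at k
      rw [k]
      exact aux_upper hb0 hb1 _
    · refine EReal.ge_of_forall_gt_iff_ge.1 fun c hc => ?_
      obtain ⟨w, hw⟩ := aux_lower hb0 hb1 c (EReal.coe_lt_coe_iff.1 hc)
      rw [← key w] at hw
      exact (EReal.coe_le_coe_iff.2 hw.le).trans
        (le_iSup (fun u : ℝ => ((u * α - Real.log (1 + Real.exp (-(y * u))) : ℝ) : EReal)) _)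
  · have hb : -(y * α) < 0 ∨ 1 < -(y * α) := by
      by_contra! hcon
      exact h ⟨by linarith, by linarith⟩
    rw [EReal.eq_top_iff_forall_lt]
    intro c
    obtain ⟨w, hw⟩ := aux_top hb c
    rw [← key w] at hw
    exact (EReal.coe_lt_coe_iff.2 hw).trans_le
      (le_iSup (fun u : ℝ => ((u * α - Real.log (1 + Real.exp (-(y * u))) : ℝ) : EReal)) _)
end

section
/- Let p ≥ 1, let x be a standard Gaussian random vector on ℝ^p (mean zero, identity covariance), let ε ∼ N(0, σ²) with σ > 0 be independent of x, and let w, w' ∈ ℝ^p with w ≠ 0. Then ℙ(sign(x^T w) ≠ sign(x^T w' + ε)) = (1/π) arccos( (w^T w') / (‖w‖₂ √(‖w'‖₂² + σ²)) ). -/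
open scoped BigOperators
open Real MeasureTheory ProbabilityTheory

/-- `sgn λ = 1` if `λ > 0` and `-1` otherwise. -/
noncomputable def sgn (t : ℝ) : ℝ := if 0 < t then 1 else -1

lemma sgn_ne_iff (a b : ℝ) : sgn a ≠ sgn b ↔ ¬ ((0 < a) ↔ (0 < b)) := by
  unfold sgn
  by_cases ha : 0 < a <;> by_cases hb : 0 < b <;> simp [ha, hb] <;> norm_num

lemma measurable_sgn : Measurable sgn := by
  unfold sgn
  exact Measurable.ite measurableSet_Ioi measurable_const measurable_const

lemma angle_set (φ : ℝ) (h0 : 0 < φ) (h1 : φ < π) :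
    {θ : ℝ | sgn (cos θ) ≠ sgn (cos (θ - φ))} ∩ Set.Ioc (-(π / 2)) (3 * π / 2)
      = Set.Ioc (-(π / 2)) (φ - π / 2) ∪ Set.Ico (π / 2) (φ + π / 2) := by
  ext θ
  simp only [Set.mem_inter_iff, Set.mem_ofPred_eq, Set.mem_Ioc, Set.mem_union, Set.mem_Ico,
    sgn_ne_iff]
  have hpi := Real.pi_pos
  constructor
  · rintro ⟨h, h2, h3⟩
    rcases lt_or_ge θ (π / 2) with h4 | h4
    · left
      refine ⟨h2, ?_⟩
      by_contra! h5
      exact h ⟨fun _ => Real.cos_pos_of_mem_Ioo ⟨by linarith, by linarith⟩,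
        fun _ => Real.cos_pos_of_mem_Ioo ⟨by linarith, by linarith⟩⟩
    · right
      refine ⟨h4, ?_⟩
      by_contra! h5
      have e1 := Real.cos_nonpos_of_pi_div_two_le_of_le h4 (by linarith)
      have e2 := Real.cos_nonpos_of_pi_div_two_le_of_le (x := θ - φ) (by linarith) (by linarith)
      exact h ⟨fun _ => by linarith, fun _ => by linarith⟩
  · rintro (⟨h2, h3⟩ | ⟨h2, h3⟩)
    · refine ⟨fun h => ?_, h2, by linarith⟩
      have e1 := h.1 (Real.cos_pos_of_mem_Ioo ⟨by linarith, by linarith⟩)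
      have e2 := Real.cos_nonpos_of_pi_div_two_le_of_le (x := -(θ - φ)) (by linarith) (by linarith)
      rw [Real.cos_neg] at e2
      linarith
    · refine ⟨fun h => ?_, by linarith, by linarith⟩
      have e1 := h.2 (Real.cos_pos_of_mem_Ioo ⟨by linarith, by linarith⟩)
      have e2 := Real.cos_nonpos_of_pi_div_two_le_of_le (x := θ) (by linarith) (by linarith)
      linarith

lemma measurableSet_angle (φ : ℝ) : MeasurableSet {θ : ℝ | sgn (cos θ) ≠ sgn (cos (θ - φ))} := by
  apply MeasurableSet.compl
  exact measurableSet_eq_fun (measurable_sgn.comp (by fun_prop)) (measurable_sgn.comp (by fun_prop))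

lemma angle_volume (φ : ℝ) (h0 : 0 < φ) (h1 : φ < π) :
    volume ({θ : ℝ | sgn (cos θ) ≠ sgn (cos (θ - φ))} ∩ Set.Ioo (-π) π)
      = ENNReal.ofReal (2 * φ) := by
  have hpi := Real.pi_pos
  set T := {θ : ℝ | sgn (cos θ) ≠ sgn (cos (θ - φ))} with hT
  have hTm : MeasurableSet T := measurableSet_angle φ
  have key : ∀ a b : ℝ, a ≤ b →
      ∫ θ in a..b, T.indicator (fun _ => (1 : ℝ)) θ = volume.real (T ∩ Set.Ioc a b) := by
    intro a b hab
    rw [intervalIntegral.integral_of_le hab, integral_indicator hTm]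
    simp [Measure.restrict_restrict hTm, measureReal_def]
  have hper : Function.Periodic (T.indicator (fun _ => (1 : ℝ))) (2 * π) := by
    intro θ
    have : θ + 2 * π ∈ T ↔ θ ∈ T := by
      simp only [hT, Set.mem_ofPred_eq]
      rw [show θ + 2 * π - φ = (θ - φ) + 2 * π by ring, Real.cos_add_two_pi, Real.cos_add_two_pi]
    by_cases h : θ ∈ T
    · rw [Set.indicator_of_mem h, Set.indicator_of_mem (this.2 h)]
    · rw [Set.indicator_of_notMem h, Set.indicator_of_notMem (fun h' => h (this.1 h'))]
  have e := hper.intervalIntegral_add_eq (-π) (-(π / 2))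
  rw [show -π + 2 * π = π by ring, show -(π / 2) + 2 * π = 3 * π / 2 by ring,
    key _ _ (by linarith), key _ _ (by linarith), angle_set φ h0 h1] at e
  have e2 : volume (Set.Ioc (-(π / 2)) (φ - π / 2) ∪ Set.Ico (π / 2) (φ + π / 2))
      = ENNReal.ofReal (2 * φ) := by
    rw [measure_union _ measurableSet_Ico, Real.volume_Ioc, Real.volume_Ico,
      ← ENNReal.ofReal_add (by linarith) (by linarith)]
    · congr 1; ring
    · rw [Set.disjoint_left]
      rintro x ⟨_, h⟩ ⟨h', _⟩
      linarith
  have e3 : volume (T ∩ Set.Ioo (-π) π) = volume (T ∩ Set.Ioc (-π) π) :=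
    measure_congr ((Filter.EventuallyEq.refl _ _).inter Ioo_ae_eq_Ioc)
  rw [e3, ← e2]
  refine (ENNReal.toReal_eq_toReal_iff' ?_ ?_).1 e
  · exact ((measure_mono Set.inter_subset_right).trans_lt (by simp)).ne
  · rw [e2]; exact ENNReal.ofReal_ne_top

lemma gauss_polar (S : Set (ℝ × ℝ)) (hS : MeasurableSet S) (T : Set ℝ) (hT : MeasurableSet T)
    (hST : ∀ r θ : ℝ, 0 < r → ((r * cos θ, r * sin θ) ∈ S ↔ θ ∈ T)) :
    ((gaussianReal 0 1).prod (gaussianReal 0 1)) S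
      = (∫⁻ r in Set.Ioi (0 : ℝ), ENNReal.ofReal (r * ((2 * π)⁻¹ * exp (-r ^ 2 / 2))))
        * volume (T ∩ Set.Ioo (-π) π) := by
  rw [gaussianReal_of_var_ne_zero 0 one_ne_zero,
    prod_withDensity (measurable_gaussianPDF 0 1) (measurable_gaussianPDF 0 1),
    withDensity_apply _ hS, ← lintegral_indicator hS, ← Measure.volume_eq_prod,
    ← lintegral_comp_polarCoord_symm, polarCoord_target]
  have : ∫⁻ p in Set.Ioi (0 : ℝ) ×ˢ Set.Ioo (-π) π, ENNReal.ofReal p.1 •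
        S.indicator (fun z : ℝ × ℝ => gaussianPDF 0 1 z.1 * gaussianPDF 0 1 z.2)
          (polarCoord.symm p)
      = ∫⁻ p in Set.Ioi (0 : ℝ) ×ˢ Set.Ioo (-π) π,
          ENNReal.ofReal (p.1 * ((2 * π)⁻¹ * exp (-p.1 ^ 2 / 2)))
          * T.indicator (fun _ => (1 : ENNReal)) p.2 := by
    refine setLIntegral_congr_fun (measurableSet_Ioi.prod measurableSet_Ioo) ?_
    rintro ⟨r, θ⟩ ⟨hr, -⟩
    have hr : 0 < r := hr
    simp only [polarCoord_symm_apply, smul_eq_mul]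
    by_cases h : θ ∈ T
    · rw [Set.indicator_of_mem h, Set.indicator_of_mem ((hST r θ hr).2 h), mul_one]
      rw [gaussianPDF, gaussianPDF, ← ENNReal.ofReal_mul (gaussianPDFReal_nonneg _ _ _),
        ← ENNReal.ofReal_mul hr.le]
      congr 2
      simp only [gaussianPDFReal, NNReal.coe_one, mul_one, sub_zero]
      rw [mul_mul_mul_comm, ← Real.exp_add, ← mul_inv, Real.mul_self_sqrt (by positivity)]
      congr 2
      have := Real.sin_sq_add_cos_sq θ
      linear_combination (-r ^ 2 / 2) * this
    · rw [Set.indicator_of_notMem h, Set.indicator_of_notMem (fun h' => h ((hST r θ hr).1 h'))]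
      simp
  rw [this, Measure.volume_eq_prod, ← Measure.prod_restrict, lintegral_prod_mul
    (f := fun r : ℝ => ENNReal.ofReal (r * ((2 * π)⁻¹ * exp (-r ^ 2 / 2))))
    (g := T.indicator (fun _ => (1 : ENNReal)))
    (by fun_prop) ((measurable_const.indicator hT).aemeasurable), lintegral_indicator hT]
  simp [Measure.restrict_restrict hT]

lemma gauss_cone (φ : ℝ) (h0 : 0 < φ) (h1 : φ < π) :
    (((gaussianReal 0 1).prod (gaussianReal 0 1))
      {p : ℝ × ℝ | sgn p.1 ≠ sgn (cos φ * p.1 + sin φ * p.2)}).toReal = 1 / π * φ := by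
  have hpi := Real.pi_pos
  have hu := gauss_polar Set.univ MeasurableSet.univ Set.univ MeasurableSet.univ (by simp)
  have hs := gauss_polar {p : ℝ × ℝ | sgn p.1 ≠ sgn (cos φ * p.1 + sin φ * p.2)}
    (MeasurableSet.compl (measurableSet_eq_fun (measurable_sgn.comp (by fun_prop))
      (measurable_sgn.comp (by fun_prop))))
    _ (measurableSet_angle φ) (by
      intro r θ hr
      simp only [Set.mem_ofPred_eq, sgn_ne_iff]
      rw [show cos φ * (r * cos θ) + sin φ * (r * sin θ) = r * cos (θ - φ) by
        rw [Real.cos_sub]; ring]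
      rw [mul_pos_iff_of_pos_left hr, mul_pos_iff_of_pos_left hr])
  rw [angle_volume φ h0 h1] at hs
  rw [hs]
  rw [measure_univ, Set.univ_inter, Real.volume_Ioo] at hu
  have hu' := congrArg ENNReal.toReal hu
  rw [ENNReal.toReal_mul, ENNReal.toReal_ofReal (by linarith)] at hu'
  rw [ENNReal.toReal_mul, ENNReal.toReal_ofReal (by linarith)]
  simp only [ENNReal.toReal_one] at hu'
  generalize (∫⁻ r in Set.Ioi (0 : ℝ),
    ENNReal.ofReal (r * ((2 * π)⁻¹ * exp (-r ^ 2 / 2)))).toReal = K at hu' ⊢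
  have hK : K = 1 / (2 * π) := by
    field_simp
    linarith
  rw [hK]
  field_simp

lemma two_dim {Ω : Type*} [MeasurableSpace Ω] (μ : Measure Ω) [IsProbabilityMeasure μ]
    (U V : Ω → ℝ) (hG : HasGaussianLaw (fun ω => (U ω, V ω)) μ)
    (hU : μ[U] = 0) (hV : μ[V] = 0) (A B C : ℝ) (hA : 0 < A) (hC : 0 < C) (hD : B ^ 2 < A * C)
    (hUU : cov[U, U; μ] = A) (hUV : cov[U, V; μ] = B) (hVV : cov[V, V; μ] = C) :
    (μ {ω | sgn (U ω) ≠ sgn (V ω)}).toReal = 1 / π * arccos (B / (√A * √C)) := by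
  have sA : 0 < √A := Real.sqrt_pos.2 hA
  have sC : 0 < √C := Real.sqrt_pos.2 hC
  have qA : √A ^ 2 = A := Real.sq_sqrt hA.le
  have qC : √C ^ 2 = C := Real.sq_sqrt hC.le
  set ρ := B / (√A * √C) with hρ
  have hρ2 : ρ ^ 2 < 1 := by
    rw [hρ, div_pow, mul_pow, qA, qC, div_lt_one (by positivity)]
    exact hD
  have hρ3 := abs_lt.1 ((sq_lt_one_iff_abs_lt_one ρ).1 hρ2)
  set φ := arccos ρ with hφ
  have c : cos φ = ρ := Real.cos_arccos hρ3.1.le hρ3.2.le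
  have h0 : 0 < φ := Real.arccos_pos.2 hρ3.2
  have h1 : φ < π := by
    refine lt_of_le_of_ne (Real.arccos_le_pi ρ) fun h => ?_
    rw [← hφ] at *
    rw [h, Real.cos_pi] at c
    linarith
  have s : 0 < sin φ := Real.sin_pos_of_pos_of_lt_pi h0 h1
  have sc := Real.sin_sq_add_cos_sq φ
  have mU : MemLp U 2 μ := hG.fst.memLp_two
  have mV : MemLp V 2 μ := hG.snd.memLp_two
  let X : Ω → ℝ := fun ω => (√A)⁻¹ * U ω
  let Y : Ω → ℝ := fun ω => (sin φ * √C)⁻¹ * V ω - (cos φ / (sin φ * √A)) * U ω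
  let L : ℝ × ℝ →L[ℝ] ℝ × ℝ :=
    ((√A)⁻¹ • ContinuousLinearMap.fst ℝ ℝ ℝ).prod
      ((sin φ * √C)⁻¹ • ContinuousLinearMap.snd ℝ ℝ ℝ
        - (cos φ / (sin φ * √A)) • ContinuousLinearMap.fst ℝ ℝ ℝ)
  have hXY : HasGaussianLaw (fun ω => (X ω, Y ω)) μ := hG.map_fun L
  have hVU : cov[V, U; μ] = B := by rw [covariance_comm, hUV]
  have iU : Integrable U μ := hG.fst.integrable
  have iV : Integrable V μ := hG.snd.integrable
  have eX : μ[X] = 0 := by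
    simp only [X]; rw [integral_const_mul, hU, mul_zero]
  have eY : μ[Y] = 0 := by
    simp only [Y]
    rw [integral_sub (iV.const_mul _) (iU.const_mul _), integral_const_mul, integral_const_mul,
      hU, hV]
    simp
  have hB : B = cos φ * √A * √C := by rw [c, hρ]; field_simp
  have vX : cov[X, X; μ] = 1 := by
    simp only [X]
    rw [covariance_const_mul_left, covariance_const_mul_right, hUU]
    field_simp
    exact qA.symm
  have cXY : cov[X, Y; μ] = 0 := by
    simp only [X, Y]
    rw [covariance_const_mul_left, covariance_fun_sub_right mU (mV.const_mul _) (mU.const_mul _),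
      covariance_const_mul_right, covariance_const_mul_right, hUU, hUV, hB]
    field_simp
    rw [qA]; ring
  have vY : cov[Y, Y; μ] = 1 := by
    simp only [Y]
    rw [covariance_fun_sub_fun_sub (mV.const_mul _) (mU.const_mul _) (mV.const_mul _)
      (mU.const_mul _)]
    simp only [covariance_const_mul_left, covariance_const_mul_right, hUU, hUV, hVV, hVU]
    rw [hB]
    field_simp
    rw [qA, qC]
    field_simp
    linarith
  have hind : IndepFun X Y μ := hXY.indepFun_of_covariance_eq_zero cXY
  have lX : μ.map X = gaussianReal 0 1 := by
    rw [hXY.fst.map_eq_gaussianReal, eX, ← covariance_self hXY.fst.aemeasurable, vX]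
    simp
  have lY : μ.map Y = gaussianReal 0 1 := by
    rw [hXY.snd.map_eq_gaussianReal, eY, ← covariance_self hXY.snd.aemeasurable, vY]
    simp
  have law := (indepFun_iff_map_prod_eq_prod_map_map hXY.fst.aemeasurable
    hXY.snd.aemeasurable).1 hind
  rw [lX, lY] at law
  have hm : MeasurableSet {p : ℝ × ℝ | sgn p.1 ≠ sgn (cos φ * p.1 + sin φ * p.2)} :=
    MeasurableSet.compl (measurableSet_eq_fun (measurable_sgn.comp (by fun_prop))
      (measurable_sgn.comp (by fun_prop)))
  rw [← gauss_cone φ h0 h1, ← law, Measure.map_apply_of_aemeasurable hXY.aemeasurable hm]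
  congr 2
  ext ω
  simp only [Set.mem_ofPred_eq, Set.mem_preimage, sgn_ne_iff]
  have e2 : cos φ * X ω + sin φ * Y ω = (√C)⁻¹ * V ω := by
    simp only [X, Y]; field_simp; ring
  rw [e2]
  simp only [X]
  rw [mul_pos_iff_of_pos_left (inv_pos.2 sA), mul_pos_iff_of_pos_left (inv_pos.2 sC)]

theorem sign_disagreement_probability
    {Ω : Type*} [MeasurableSpace Ω] (μ : Measure Ω) [IsProbabilityMeasure μ]
    (p : ℕ) (hp : 1 ≤ p) (σ : ℝ) (hσ : 0 < σ)
    (x : Ω → (Fin p → ℝ)) (ε : Ω → ℝ)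
    (hx : Measure.map x μ = Measure.pi fun _ : Fin p => gaussianReal 0 1)
    (hε : Measure.map ε μ = gaussianReal 0 ⟨σ ^ 2, sq_nonneg σ⟩)
    (hind : IndepFun x ε μ)
    (w w' : Fin p → ℝ) (hw : w ≠ 0) :
    (μ {ω | sgn (∑ j, x ω j * w j) ≠ sgn (∑ j, x ω j * w' j + ε ω)}).toReal
      = (1 / π) * Real.arccos ((∑ j, w j * w' j) /
          (Real.sqrt (∑ j, (w j) ^ 2) * Real.sqrt ((∑ j, (w' j) ^ 2) + σ ^ 2))) := by
  obtain ⟨v, hv, hε'⟩ : ∃ v : NNReal, (v : ℝ) = σ ^ 2 ∧ Measure.map ε μ = gaussianReal 0 v :=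
    ⟨_, rfl, hε⟩
  have mx : AEMeasurable x μ := by
    apply AEMeasurable.of_map_ne_zero
    rw [hx]
    exact IsProbabilityMeasure.ne_zero _
  have mε : AEMeasurable ε μ := by
    apply AEMeasurable.of_map_ne_zero
    rw [hε']
    exact IsProbabilityMeasure.ne_zero _
  have mxj : ∀ j, AEMeasurable (fun ω => x ω j) μ := fun j =>
    (measurable_pi_apply j).comp_aemeasurable mx
  have lxj : ∀ j, μ.map (fun ω => x ω j) = gaussianReal 0 1 := by
    intro j
    have h := (measurePreserving_eval (fun _ : Fin p => gaussianReal 0 1) j).map_eq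
    rw [← hx, AEMeasurable.map_map_of_aemeasurable (measurable_pi_apply j).aemeasurable mx] at h
    exact h
  have gxj : ∀ j, HasGaussianLaw (fun ω => x ω j) μ := fun j =>
    ⟨by rw [lxj j]; infer_instance⟩
  have gε : HasGaussianLaw ε μ := ⟨by rw [hε']; infer_instance⟩
  have hii : iIndepFun (fun j ω => x ω j) μ := by
    rw [iIndepFun_iff_map_fun_eq_pi_map mxj]
    simp only [lxj]
    exact hx
  have gx : HasGaussianLaw x μ := hii.hasGaussianLaw gxj
  have gxε : HasGaussianLaw (fun ω => (x ω, ε ω)) μ := hind.hasGaussianLaw gx gε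
  have Lxj : ∀ j, MemLp (fun ω => x ω j) 2 μ := fun j => (gxj j).memLp_two
  have Lε : MemLp ε 2 μ := gε.memLp_two
  have exj : ∀ j, ∫ ω, x ω j ∂μ = 0 := by
    intro j
    have := integral_map (mxj j) (f := fun y : ℝ => y) (by fun_prop)
    rw [← this, lxj j, integral_id_gaussianReal]
  have eε : ∫ ω, ε ω ∂μ = 0 := by
    have := integral_map mε (f := fun y : ℝ => y) (by fun_prop)
    rw [← this, hε', integral_id_gaussianReal]
  have cx : ∀ i j, cov[fun ω => x ω i, fun ω => x ω j; μ] = if i = j then 1 else 0 := by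
    intro i j
    split_ifs with h
    · subst h
      rw [covariance_self (mxj i), ← variance_id_map (mxj i), lxj i, variance_id_gaussianReal]
      simp
    · exact (hii.indepFun h).covariance_eq_zero (Lxj i) (Lxj j)
  have cxε : ∀ j, cov[fun ω => x ω j, ε; μ] = 0 := by
    intro j
    exact (hind.comp (measurable_pi_apply j) measurable_id).covariance_eq_zero (Lxj j) Lε
  have cε : cov[ε, ε; μ] = σ ^ 2 := by
    rw [covariance_self mε, ← variance_id_map mε, hε', variance_id_gaussianReal, hv]
  have Lw : ∀ (v : Fin p → ℝ), MemLp (fun ω => ∑ j, x ω j * v j) 2 μ := fun v =>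
    memLp_finsetSum _ fun j _ => (Lxj j).mul_const _
  have cww : ∀ v v' : Fin p → ℝ,
      cov[fun ω => ∑ j, x ω j * v j, fun ω => ∑ j, x ω j * v' j; μ] = ∑ j, v j * v' j := by
    intro v v'
    rw [covariance_fun_sum_fun_sum (fun j => (Lxj j).mul_const _) (fun j => (Lxj j).mul_const _)]
    simp only [covariance_mul_const_left, covariance_mul_const_right, cx]
    simp
  have cwε : ∀ v : Fin p → ℝ, cov[fun ω => ∑ j, x ω j * v j, ε; μ] = 0 := by
    intro v
    rw [covariance_fun_sum_left (fun j => (Lxj j).mul_const _) Lε]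
    simp [covariance_mul_const_left, cxε]
  have ew : ∀ v : Fin p → ℝ, ∫ ω, ∑ j, x ω j * v j ∂μ = 0 := by
    intro v
    rw [integral_finsetSum _ (fun j _ => (gxj j).integrable.mul_const _)]
    simp [integral_mul_const, exj]
  let ℓ : (Fin p → ℝ) → ((Fin p → ℝ) →L[ℝ] ℝ) := fun v =>
    ∑ j, v j • ContinuousLinearMap.proj (R := ℝ) (φ := fun _ : Fin p => ℝ) j
  have hℓ : ∀ v y, ℓ v y = ∑ j, y j * v j := by
    intro v y
    simp [ℓ, mul_comm]
  have hG : HasGaussianLaw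
      (fun ω => (∑ j, x ω j * w j, ∑ j, x ω j * w' j + ε ω)) μ := by
    have := gxε.map_fun (((ℓ w).comp (ContinuousLinearMap.fst ℝ _ ℝ)).prod
      ((ℓ w').comp (ContinuousLinearMap.fst ℝ _ ℝ) + ContinuousLinearMap.snd ℝ _ ℝ))
    simpa [hℓ] using this
  have hA : 0 < ∑ j, w j ^ 2 := by
    obtain ⟨j, hj⟩ := Function.ne_iff.1 hw
    exact Finset.sum_pos' (fun i _ => sq_nonneg _) ⟨j, Finset.mem_univ _, by
      have : w j ≠ 0 := hj
      positivity⟩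
  have hC : 0 < ∑ j, w' j ^ 2 + σ ^ 2 := by positivity
  refine two_dim μ _ _ hG (ew w) ?_ _ _ _ hA hC ?_ ?_ ?_ ?_
  · rw [integral_add (Lw w' |>.integrable (by norm_num)) gε.integrable, ew, eε, add_zero]
  · have := Finset.sum_mul_sq_le_sq_mul_sq Finset.univ w w'
    have h2 : 0 < (∑ j, w j ^ 2) * σ ^ 2 := by positivity
    linarith [mul_add (∑ j, w j ^ 2) (∑ j, w' j ^ 2) (σ ^ 2)]
  · rw [cww]; simp [sq]
  · have := covariance_add_right (Lw w) (Lw w') Lε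
    rw [cww, cwε, add_zero] at this
    exact this
  · have h1 := covariance_add_right ((Lw w').add Lε) (Lw w') Lε
    have h2 := covariance_add_left (Lw w') Lε (Lw w')
    have h3 := covariance_add_left (Lw w') Lε Lε
    rw [h2, h3, cww, cwε, covariance_comm ε, cwε, cε] at h1
    simp only [add_zero, zero_add, ← sq] at h1
    exact h1
end

section
/- Let p ≥ 1, let x be a standard Gaussian random vector on ℝ^p, let ε ∼ N(0, σ²) with σ > 0 be independent of x, and let w, w* ∈ {0,1}^p with exactly k ≥ 1 nonzero entries each and w^T w* = ℓ where 0 ≤ ℓ < k. Let Z := 1(sign(x^T w) ≠ sign(x^T w* + ε)) − 1(sign(x^T w*) ≠ sign(x^T w* + ε)). Then E[Z] ≥ (1/π) · (k−ℓ)/√(k(k+σ²) − ℓ²) > 0. -/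
open scoped BigOperators
open Real MeasureTheory ProbabilityTheory
lemma sgn_mul_pos {c : ℝ} (hc : 0 < c) (t : ℝ) : sgn (c * t) = sgn t := by
  simp [sgn, hc]

noncomputable def dis (s t : ℝ) : ℝ := if sgn s ≠ sgn t then 1 else 0

lemma measurable_dis : Measurable (fun p : ℝ × ℝ => dis p.1 p.2) := by
  unfold dis
  refine Measurable.ite ?_ measurable_const measurable_const
  exact (measurableSet_eq_fun (measurable_sgn.comp measurable_fst)
    (measurable_sgn.comp measurable_snd)).compl

lemma abs_dis_le (s t : ℝ) : ‖dis s t‖ ≤ 1 := by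
  unfold dis; split_ifs <;> simp

lemma dis_pos_pos {s t : ℝ} (hs : 0 < s) (ht : 0 < t) : dis s t = 0 := by
  simp [dis, sgn, hs, ht]
lemma dis_neg_neg {s t : ℝ} (hs : s < 0) (ht : t < 0) : dis s t = 0 := by
  simp [dis, sgn, hs.not_gt, ht.not_gt]
lemma dis_pos_neg {s t : ℝ} (hs : 0 < s) (ht : t < 0) : dis s t = 1 := by
  simp [dis, sgn, hs, ht.not_gt]; norm_num
lemma dis_neg_pos {s t : ℝ} (hs : s < 0) (ht : 0 < t) : dis s t = 1 := by
  simp [dis, sgn, hs.not_gt, ht]; norm_num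

lemma integral_gauss_prod (f : ℝ × ℝ → ℝ) :
    ∫ p, f p ∂((gaussianReal 0 1).prod (gaussianReal 0 1)) =
      ∫ p : ℝ × ℝ, ((2 * π)⁻¹ * rexp (-(p.1 ^ 2 + p.2 ^ 2) / 2)) * f p := by
  rw [gaussianReal_of_var_ne_zero 0 one_ne_zero,
    prod_withDensity (measurable_gaussianPDF _ _) (measurable_gaussianPDF _ _),
    integral_withDensity_eq_integral_toReal_smul]
  · refine integral_congr_ae (Filter.Eventually.of_forall fun p => ?_)
    simp only [ENNReal.toReal_mul, toReal_gaussianPDF, smul_eq_mul, gaussianPDFReal]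
    congr 1
    have : rexp (-(p.1 ^ 2 + p.2 ^ 2) / 2) = rexp (-p.1 ^ 2 / 2) * rexp (-p.2 ^ 2 / 2) := by
      rw [← Real.exp_add]; congr 1; ring
    rw [this]
    have h2 : (2 * π)⁻¹ = (√(2 * π))⁻¹ * (√(2 * π))⁻¹ := by
      rw [← mul_inv, Real.mul_self_sqrt (by positivity)]
    rw [h2]
    simp
    ring
  · exact ((measurable_gaussianPDF _ _).comp measurable_fst).mul
      ((measurable_gaussianPDF _ _).comp measurable_snd)
  · exact Filter.Eventually.of_forall fun p =>
      ENNReal.mul_lt_top gaussianPDF_lt_top gaussianPDF_lt_top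

lemma integral_gauss_polar (f : ℝ × ℝ → ℝ) (h : ℝ → ℝ)
    (hf : ∀ r θ, 0 < r → f (r * cos θ, r * sin θ) = h θ) :
    ∫ p, f p ∂((gaussianReal 0 1).prod (gaussianReal 0 1)) =
      (∫ r in Set.Ioi (0 : ℝ), r * rexp (- r ^ 2 / 2)) *
        ∫ θ in Set.Ioo (-π) π, (2 * π)⁻¹ * h θ := by
  rw [integral_gauss_prod, ← integral_comp_polarCoord_symm, ← setIntegral_prod_mul]
  refine setIntegral_congr_fun polarCoord.open_target.measurableSet ?_
  rintro ⟨r, θ⟩ ⟨hr, hθ⟩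
  simp only [polarCoord_symm_apply, smul_eq_mul]
  rw [hf r θ hr]
  have : (r * cos θ) ^ 2 + (r * sin θ) ^ 2 = r ^ 2 := by
    linear_combination r ^ 2 * (sin_sq_add_cos_sq θ)
  rw [this]; ring

lemma radial_eq : ∫ r in Set.Ioi (0 : ℝ), r * rexp (- r ^ 2 / 2) = 1 := by
  have := integral_gauss_polar (fun _ => 1) (fun _ => 1) (fun _ _ _ => rfl)
  simp only [integral_const, probReal_univ, smul_eq_mul, mul_one] at this
  simp only [Measure.real, Measure.restrict_apply_univ, Real.volume_Ioo] at this
  rw [ENNReal.toReal_ofReal (by linarith [pi_pos])] at this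
  have h2 : (π - -π) * (2 * π)⁻¹ = 1 := by
    field_simp; ring
  rw [h2, mul_one] at this
  exact this.symm

lemma sector (α : ℝ) (h0 : 0 < α) (hπ : α < π) :
    ∫ p, dis p.1 (cos α * p.1 + sin α * p.2) ∂((gaussianReal 0 1).prod (gaussianReal 0 1))
      = α / π := by
  set h : ℝ → ℝ := fun θ => dis (cos θ) (cos (θ - α)) with hh
  rw [integral_gauss_polar _ h ?_, radial_eq, one_mul, integral_const_mul]
  swap
  · intro r θ hr
    have : cos α * (r * cos θ) + sin α * (r * sin θ) = r * cos (θ - α) := by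
      rw [cos_sub]; ring
    simp only [hh, this, dis, sgn_mul_pos hr]
  have hm : Measurable h :=
    measurable_dis.comp (f := fun θ : ℝ => (cos θ, cos (θ - α))) (by fun_prop)
  have hi : ∀ a b, IntervalIntegrable h volume a b := fun a b => by
    refine (intervalIntegrable_const (c := (1:ℝ))).mono_fun' hm.aestronglyMeasurable ?_
    exact Filter.Eventually.of_forall fun θ => abs_dis_le _ _
  have hper : Function.Periodic h (2 * π) := fun θ => by
    simp only [hh]
    rw [cos_add_two_pi, show θ + 2 * π - α = (θ - α) + 2 * π by ring, cos_add_two_pi]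
  rw [← integral_Ioc_eq_integral_Ioo,
    ← intervalIntegral.integral_of_le (by linarith [pi_pos])]
  have e1 := hper.intervalIntegral_add_eq (-π) (-(π / 2))
  rw [show -π + 2 * π = π by ring] at e1
  rw [e1, ← intervalIntegral.integral_add_adjacent_intervals (hi _ (α - π / 2)) (hi _ _),
    ← intervalIntegral.integral_add_adjacent_intervals (hi (α - π / 2) (π / 2)) (hi _ _),
    ← intervalIntegral.integral_add_adjacent_intervals (hi (π / 2) (α + π / 2)) (hi _ _)]
  have key : ∀ (a b c : ℝ), a ≤ b → (∀ θ, a < θ → θ < b → h θ = c) →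
      ∫ θ in a..b, h θ = (b - a) * c := by
    intro a b c hab hc
    rw [intervalIntegral.integral_of_le hab, integral_Ioc_eq_integral_Ioo,
      setIntegral_congr_fun measurableSet_Ioo (g := fun _ => c) (fun θ hθ => hc θ hθ.1 hθ.2)]
    simp [Measure.real, ENNReal.toReal_ofReal (sub_nonneg.2 hab)]
  have cneg : ∀ t, -(3 * π / 2) < t → t < -(π / 2) → cos t < 0 := by
    intro t h1 h2
    rw [← cos_neg]
    exact cos_neg_of_pi_div_two_lt_of_lt (by linarith) (by linarith)
  rw [key _ (α - π / 2) 1 (by linarith), key (α - π / 2) (π / 2) 0 (by linarith),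
    key (π / 2) (α + π / 2) 1 (by linarith), key (α + π / 2) _ 0 (by linarith)]
  · field_simp; ring
  · intro θ h1 h2
    exact dis_neg_neg (cos_neg_of_pi_div_two_lt_of_lt (by linarith) (by linarith))
      (cos_neg_of_pi_div_two_lt_of_lt (by linarith) (by linarith))
  · intro θ h1 h2
    exact dis_neg_pos (cos_neg_of_pi_div_two_lt_of_lt (by linarith) (by linarith))
      (cos_pos_of_mem_Ioo ⟨by linarith, by linarith⟩)
  · intro θ h1 h2
    exact dis_pos_pos (cos_pos_of_mem_Ioo ⟨by linarith, by linarith⟩)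
      (cos_pos_of_mem_Ioo ⟨by linarith, by linarith⟩)
  · intro θ h1 h2
    exact dis_pos_neg (cos_pos_of_mem_Ioo ⟨by linarith, by linarith⟩)
      (cneg _ (by linarith) (by linarith))

lemma dis_gauss {Ω : Type*} [MeasurableSpace Ω] (μ : Measure Ω) [IsProbabilityMeasure μ]
    (U V : Ω → ℝ) (h : HasGaussianLaw (fun ω => (U ω, V ω)) μ)
    (hU : ∫ ω, U ω ∂μ = 0) (hV : ∫ ω, V ω ∂μ = 0) (a b ρ : ℝ) (ha : 0 < a) (hb : 0 < b)
    (h1 : -1 < ρ) (h2 : ρ < 1) (hUU : cov[U, U; μ] = a ^ 2) (hVV : cov[V, V; μ] = b ^ 2)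
    (hUV : cov[U, V; μ] = a * b * ρ) :
    Integrable (fun ω => dis (U ω) (V ω)) μ ∧ ∫ ω, dis (U ω) (V ω) ∂μ = arccos ρ / π := by
  refine ⟨?_, ?_⟩
  · refine Integrable.of_bound (C := 1)
      (measurable_dis.comp_aemeasurable h.aemeasurable).aestronglyMeasurable ?_
    exact Filter.Eventually.of_forall fun ω => abs_dis_le _ _
  set α := arccos ρ with hα
  have hc : cos α = ρ := cos_arccos h1.le h2.le
  have hα0 : 0 < α := arccos_pos.2 h2
  have hαπ : α < π := by
    rw [hα]; exact lt_of_le_of_ne (arccos_le_pi _) (fun h => by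
      rw [arccos_eq_pi] at h; linarith)
  have hs : 0 < sin α := sin_pos_of_pos_of_lt_pi hα0 hαπ
  have hsc : sin α ^ 2 = 1 - ρ ^ 2 := by rw [← hc]; linarith [sin_sq_add_cos_sq α]
  have mU : MemLp U 2 μ := h.fst.memLp_two
  have mV : MemLp V 2 μ := h.snd.memLp_two
  set s := sin α with hsdef
  set A : Ω → ℝ := fun ω => a⁻¹ * U ω with hA
  set B : Ω → ℝ := fun ω => (b * s)⁻¹ * V ω - (ρ * (s * a)⁻¹) * U ω with hB
  have hAB : HasGaussianLaw (fun ω => (A ω, B ω)) μ :=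
    h.map_fun (ContinuousLinearMap.prod (a⁻¹ • ContinuousLinearMap.fst ℝ ℝ ℝ)
      ((b * s)⁻¹ • ContinuousLinearMap.snd ℝ ℝ ℝ - (ρ * (s * a)⁻¹) • ContinuousLinearMap.fst ℝ ℝ ℝ))
  have hVU : cov[V, U; μ] = a * b * ρ := by rw [covariance_comm, hUV]
  have cAA : cov[A, A; μ] = 1 := by
    rw [hA, covariance_const_mul_left, covariance_const_mul_right, hUU]; field_simp
  have cAB : cov[A, B; μ] = 0 := by
    rw [hA, hB, covariance_const_mul_left,
      covariance_fun_sub_right mU (mV.const_mul _) (mU.const_mul _),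
      covariance_const_mul_right, covariance_const_mul_right, hUU, hUV]
    field_simp; ring
  have cBB : cov[B, B; μ] = 1 := by
    rw [hB, covariance_fun_sub_fun_sub (mV.const_mul _) (mU.const_mul _)
      (mV.const_mul _) (mU.const_mul _)]
    simp only [covariance_const_mul_right, covariance_const_mul_left, hUU, hUV, hVV, hVU]
    field_simp
    rw [hsc]; ring
  have iA : ∫ ω, A ω ∂μ = 0 := by rw [hA, integral_const_mul, hU, mul_zero]
  have iB : ∫ ω, B ω ∂μ = 0 := by
    rw [hB, integral_sub ((mV.integrable (by norm_num)).const_mul _)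
      ((mU.integrable (by norm_num)).const_mul _), integral_const_mul, integral_const_mul, hU, hV]
    simp
  have lA : μ.map A = gaussianReal 0 1 := by
    rw [hAB.fst.map_eq_gaussianReal, iA, ← covariance_self hAB.fst.aemeasurable, cAA]; simp
  have lB : μ.map B = gaussianReal 0 1 := by
    rw [hAB.snd.map_eq_gaussianReal, iB, ← covariance_self hAB.snd.aemeasurable, cBB]; simp
  have hlaw := (indepFun_iff_map_prod_eq_prod_map_map hAB.fst.aemeasurable
    hAB.snd.aemeasurable).1 (hAB.indepFun_of_covariance_eq_zero cAB)
  rw [lA, lB] at hlaw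
  rw [← sector α hα0 hαπ, ← hlaw, integral_map hAB.aemeasurable]
  · refine integral_congr_ae (Filter.Eventually.of_forall fun ω => ?_)
    have e1 : U ω = a * A ω := by simp only [hA]; field_simp
    have e2 : V ω = b * (cos α * A ω + sin α * B ω) := by
      rw [hc, ← hsdef]; simp only [hA, hB]; field_simp; ring
    simp only [dis]
    rw [e1, e2, sgn_mul_pos ha, sgn_mul_pos hb]
  · exact (measurable_dis.comp (f := fun p : ℝ × ℝ => (p.1, cos α * p.1 + sin α * p.2))
      (by fun_prop)).aestronglyMeasurable

lemma arccos_sub_lower {s t : ℝ} (hs : 0 ≤ s) (hst : s ≤ t) (ht : t < 1) :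
    (1 / √(1 - s ^ 2)) * (t - s) ≤ arccos s - arccos t := by
  have := (convex_Icc s t).mul_sub_le_image_sub_of_le_deriv (f := fun x => - arccos x)
    (C := 1 / √(1 - s ^ 2)) (by fun_prop) ?_ ?_ s ⟨le_rfl, hst⟩ t ⟨hst, le_rfl⟩ hst
  · linarith
  · intro x hx
    rw [interior_Icc] at hx
    exact (hasDerivAt_arccos (by linarith [hx.1]) (by linarith [hx.2])).neg.differentiableAt.differentiableWithinAt
  · intro x hx
    rw [interior_Icc] at hx
    rw [(hasDerivAt_arccos (by linarith [hx.1]) (by linarith [hx.2])).fun_neg.deriv, neg_neg]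
    have : 0 < 1 - x ^ 2 := by nlinarith [hx.1, hx.2]
    refine one_div_le_one_div_of_le (Real.sqrt_pos.2 this) (Real.sqrt_le_sqrt ?_)
    nlinarith [hx.1, hx.2]

theorem mean_misclassification_difference_lower_bound
    {Ω : Type*} [MeasurableSpace Ω] (μ : Measure Ω) [IsProbabilityMeasure μ]
    (p k ℓ : ℕ) (hp : 1 ≤ p) (hk : 1 ≤ k) (hℓk : ℓ < k)
    (σ : ℝ) (hσ : 0 < σ)
    (x : Ω → (Fin p → ℝ)) (ε : Ω → ℝ)
    (hx : Measure.map x μ = Measure.pi fun _ : Fin p => gaussianReal 0 1)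
    (hε : Measure.map ε μ = gaussianReal 0 ⟨σ ^ 2, sq_nonneg σ⟩)
    (hind : IndepFun x ε μ)
    (w wstar : Fin p → ℝ)
    (hw01 : ∀ j, w j = 0 ∨ w j = 1) (hwstar01 : ∀ j, wstar j = 0 ∨ wstar j = 1)
    (hwk : (Finset.univ.filter fun j => w j ≠ 0).card = k)
    (hwstark : (Finset.univ.filter fun j => wstar j ≠ 0).card = k)
    (hℓ : ∑ j, w j * wstar j = (ℓ : ℝ)) :
    (∫ ω, ((if sgn (∑ j, x ω j * w j) ≠ sgn (∑ j, x ω j * wstar j + ε ω) then (1 : ℝ) else 0)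
        - (if sgn (∑ j, x ω j * wstar j) ≠ sgn (∑ j, x ω j * wstar j + ε ω) then (1 : ℝ) else 0)) ∂μ)
      ≥ (1 / π) * (((k : ℝ) - (ℓ : ℝ)) /
          Real.sqrt ((k : ℝ) * ((k : ℝ) + σ ^ 2) - (ℓ : ℝ) ^ 2))
    ∧ 0 < (1 / π) * (((k : ℝ) - (ℓ : ℝ)) /
          Real.sqrt ((k : ℝ) * ((k : ℝ) + σ ^ 2) - (ℓ : ℝ) ^ 2)) := by
  have hk0 : (0:ℝ) < k := by exact_mod_cast hk
  have hl0 : (0:ℝ) ≤ ℓ := by positivity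
  have hlk : (ℓ:ℝ) < k := by exact_mod_cast hℓk
  have hσ2 : 0 < σ ^ 2 := by positivity
  have hD : 0 < (k : ℝ) * ((k : ℝ) + σ ^ 2) - (ℓ : ℝ) ^ 2 := by nlinarith [mul_pos hk0 hσ2]
  refine ⟨?_, mul_pos (by positivity) (div_pos (by linarith) (Real.sqrt_pos.2 hD))⟩
  -- laws
  obtain ⟨v, hv, hε⟩ : ∃ v : NNReal, (v : ℝ) = σ ^ 2 ∧ Measure.map ε μ = gaussianReal 0 v :=
    ⟨⟨σ ^ 2, sq_nonneg σ⟩, rfl, hε⟩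
  have mx : AEMeasurable x μ := AEMeasurable.of_map_ne_zero (by rw [hx]; exact NeZero.ne _)
  have mε : AEMeasurable ε μ := AEMeasurable.of_map_ne_zero (by rw [hε]; exact NeZero.ne _)
  have hxj : ∀ j, μ.map (fun ω => x ω j) = gaussianReal 0 1 := by
    intro j
    have := (measurePreserving_eval (fun _ : Fin p => gaussianReal 0 1) j).map_eq
    rw [← hx, AEMeasurable.map_map_of_aemeasurable (measurable_pi_apply j).aemeasurable mx] at this
    exact this
  have mxj : ∀ j, AEMeasurable (fun ω => x ω j) μ := fun j =>
    (measurable_pi_apply j).comp_aemeasurable mx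
  have hxi : iIndepFun (fun j ω => x ω j) μ := by
    rw [iIndepFun_iff_map_fun_eq_pi_map mxj]
    simp only [hxj]
    exact hx
  have gxj : ∀ j, HasGaussianLaw (fun ω => x ω j) μ := fun j => ⟨by rw [hxj]; infer_instance⟩
  have gε : HasGaussianLaw ε μ := ⟨by rw [hε]; infer_instance⟩
  have gx : HasGaussianLaw x μ := hxi.hasGaussianLaw gxj
  have gxε : HasGaussianLaw (fun ω => (x ω, ε ω)) μ := hind.hasGaussianLaw gx gε
  have ixj : ∀ j, ∫ ω, x ω j ∂μ = 0 := fun j => by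
    have := integral_id_gaussianReal (μ := 0) (v := 1)
    rwa [← hxj j, integral_map (mxj j) (by fun_prop)] at this
  have iε : ∫ ω, ε ω ∂μ = 0 := by
    have := integral_id_gaussianReal (μ := 0) (v := v)
    rwa [← hε, integral_map mε (by fun_prop)] at this
  have m2 : ∀ j, MemLp (fun ω => x ω j) 2 μ := fun j => (gxj j).memLp_two
  have mε2 : MemLp ε 2 μ := gε.memLp_two
  have cjj : ∀ i j, cov[fun ω => x ω i, fun ω => x ω j; μ] = if i = j then 1 else 0 := by
    intro i j
    split_ifs with hij
    · subst hij
      rw [covariance_self (mxj i)]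
      have := variance_fun_id_gaussianReal (μ := 0) (v := 1)
      rw [← hxj i, variance_map (by fun_prop) (mxj i)] at this
      simpa [Function.comp_def] using this
    · exact (hxi.indepFun hij).covariance_eq_zero (m2 i) (m2 j)
  have cεε : cov[ε, ε; μ] = σ ^ 2 := by
    rw [covariance_self mε]
    have := variance_fun_id_gaussianReal (μ := 0) (v := v)
    rw [← hε, variance_map (by fun_prop) mε, hv] at this
    simpa [Function.comp_def] using this
  -- linear forms
  let S : (Fin p → ℝ) → Ω → ℝ := fun u ω => ∑ j, x ω j * u j
  have mS : ∀ u, MemLp (S u) 2 μ := fun u =>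
    memLp_finsetSum _ (fun j _ => (m2 j).mul_const (u j))
  have iS : ∀ u, ∫ ω, S u ω ∂μ = 0 := by
    intro u
    simp only [S]
    rw [integral_finsetSum _ (fun j _ => ((m2 j).integrable (by norm_num)).mul_const _)]
    simp [integral_mul_const, ixj]
  have cS : ∀ u v, cov[S u, S v; μ] = ∑ j, u j * v j := by
    intro u v
    simp only [S]
    rw [covariance_fun_sum_fun_sum (fun j => (m2 j).mul_const (u j))
      (fun j => (m2 j).mul_const (v j))]
    simp [covariance_mul_const_left, covariance_mul_const_right, cjj]
  have cSε : ∀ u, cov[S u, ε; μ] = 0 := by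
    intro u
    refine IndepFun.covariance_eq_zero ?_ (mS u) mε2
    exact hind.comp (φ := fun y : Fin p → ℝ => ∑ j, y j * u j) (ψ := id) (by fun_prop) measurable_id
  let W : Ω → ℝ := fun ω => S wstar ω + ε ω
  have iW : ∫ ω, W ω ∂μ = 0 := by
    simp only [W]
    rw [integral_add ((mS _).integrable (by norm_num)) (mε2.integrable (by norm_num)), iS, iε,
      add_zero]
  have cSW : ∀ u, cov[S u, W; μ] = ∑ j, u j * wstar j := by
    intro u
    have := covariance_add_right (mS u) (mS wstar) mε2
    rw [cSε, cS, add_zero] at this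
    exact this
  have hsum : ∀ u : Fin p → ℝ, (∀ j, u j = 0 ∨ u j = 1) →
      (Finset.univ.filter fun j => u j ≠ 0).card = k → ∑ j, u j * u j = (k : ℝ) := by
    intro u hu huk
    rw [← huk, Finset.card_filter]
    push_cast
    refine Finset.sum_congr rfl fun j _ => ?_
    rcases hu j with h | h <;> simp [h]
  have hww := hsum w hw01 hwk
  have hss := hsum wstar hwstar01 hwstark
  have cWW : cov[W, W; μ] = k + σ ^ 2 := by
    have := covariance_add_left (mS wstar) mε2 ((mS wstar).add mε2)
    have h2 := covariance_add_right mε2 (mS wstar) mε2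
    rw [h2, covariance_comm ε, cSε, cεε, zero_add] at this
    have h3 := cSW wstar
    rw [hss] at h3
    rw [← h3]
    exact this
  have gSW : ∀ u, HasGaussianLaw (fun ω => (S u ω, W ω)) μ := by
    intro u
    let T : (Fin p → ℝ) → ((Fin p → ℝ) →L[ℝ] ℝ) := fun u =>
      ∑ j, u j • ContinuousLinearMap.proj (R := ℝ) (φ := fun _ : Fin p => ℝ) j
    have hT : ∀ u y, T u y = ∑ j, y j * u j := by
      intro u y
      simp [T, mul_comm]
    have := gxε.map_fun (ContinuousLinearMap.prod
      ((T u).comp (ContinuousLinearMap.fst ℝ (Fin p → ℝ) ℝ))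
      ((T wstar).comp (ContinuousLinearMap.fst ℝ (Fin p → ℝ) ℝ)
        + ContinuousLinearMap.snd ℝ (Fin p → ℝ) ℝ))
    simpa [hT, S, W] using this
  set a := √(k : ℝ) with ha
  set b := √((k : ℝ) + σ ^ 2) with hb
  have ha0 : 0 < a := Real.sqrt_pos.2 hk0
  have hb0 : 0 < b := Real.sqrt_pos.2 (by positivity)
  have ha2 : a ^ 2 = k := Real.sq_sqrt hk0.le
  have hb2 : b ^ 2 = k + σ ^ 2 := Real.sq_sqrt (by positivity)
  have hab : 0 < a * b := mul_pos ha0 hb0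
  have hab2 : (a * b) ^ 2 = k * (k + σ ^ 2) := by rw [mul_pow, ha2, hb2]
  have hkab : (k : ℝ) < a * b := by
    refine lt_of_pow_lt_pow_left₀ 2 hab.le ?_
    rw [hab2]; nlinarith [mul_pos hk0 hσ2]
  have ht1 : (k : ℝ) / (a * b) < 1 := (div_lt_one hab).2 hkab
  have hst : (ℓ : ℝ) / (a * b) ≤ k / (a * b) := by gcongr
  have hs0 : 0 ≤ (ℓ : ℝ) / (a * b) := by positivity
  obtain ⟨I1, E1⟩ := dis_gauss μ (S w) W (gSW w) (iS w) iW a b (ℓ / (a * b)) ha0 hb0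
    (by linarith) (by linarith) (by rw [cS, hww, ha2]) (by rw [cWW, hb2])
    (by rw [cSW, hℓ]; field_simp)
  obtain ⟨I2, E2⟩ := dis_gauss μ (S wstar) W (gSW wstar) (iS wstar) iW a b (k / (a * b)) ha0 hb0
    (by linarith) (by linarith) (by rw [cS, hss, ha2]) (by rw [cWW, hb2])
    (by rw [cSW, hss]; field_simp)
  have hmain : ∫ ω, (dis (S w ω) (W ω) - dis (S wstar ω) (W ω)) ∂μ
      = arccos (ℓ / (a * b)) / π - arccos (k / (a * b)) / π := by
    rw [integral_sub I1 I2, E1, E2]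
  change ∫ ω, (dis (S w ω) (W ω) - dis (S wstar ω) (W ω)) ∂μ ≥ _
  rw [hmain, ← sub_div, ge_iff_le, div_eq_inv_mul (arccos _ - _), ← one_div]
  refine mul_le_mul_of_nonneg_left ?_ (by positivity)
  refine le_trans (le_of_eq ?_) (arccos_sub_lower hs0 hst ht1)
  have : 1 - ((ℓ : ℝ) / (a * b)) ^ 2 = ((k : ℝ) * (k + σ ^ 2) - (ℓ : ℝ) ^ 2) / (a * b) ^ 2 := by
    rw [← hab2]; field_simp
  rw [this, Real.sqrt_div hD.le, Real.sqrt_sq hab.le]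
  have := Real.sqrt_pos.2 hD
  field_simp
end

section
/- Let k ≥ 1 and p ≥ 2k be integers and σ ≥ 0 a real number. Then for every integer ℓ with 0 ≤ ℓ ≤ k−1, (2π² (k(k+σ²) − ℓ²) / (k−ℓ)²) · [ log k + log C(k,ℓ) + log C(p−k, k−ℓ) ] ≤ 6π² (2 + σ²) k log(p−k). -/
open Real

/-- The union-bound sample-size threshold is at most `n₀ = 6π²(2+σ²)k log(p−k)`. -/
theorem threshold_upper_bound
    (k p : ℕ) (hk : 1 ≤ k) (hp : 2 * k ≤ p) (σ : ℝ) (hσ : 0 ≤ σ)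
    (ℓ : ℕ) (hℓ : ℓ ≤ k - 1) :
    (2 * π ^ 2 * ((k : ℝ) * ((k : ℝ) + σ ^ 2) - (ℓ : ℝ) ^ 2) / ((k : ℝ) - (ℓ : ℝ)) ^ 2) *
        (Real.log (k : ℝ) + Real.log (Nat.choose k ℓ : ℝ)
          + Real.log (Nat.choose (p - k) (k - ℓ) : ℝ))
      ≤ 6 * π ^ 2 * (2 + σ ^ 2) * (k : ℝ) * Real.log ((p : ℝ) - (k : ℝ)) := by
  obtain ⟨m, rfl⟩ : ∃ m, k = ℓ + m := ⟨k - ℓ, by omega⟩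
  obtain ⟨N, rfl⟩ : ∃ N, p = (ℓ + m) + N := ⟨p - (ℓ + m), by omega⟩
  have hm : 1 ≤ m := by omega
  have hN : ℓ + m ≤ N := by omega
  have e1 : ℓ + m + N - (ℓ + m) = N := by omega
  have e2 : ℓ + m - ℓ = m := by omega
  have e3 : (((ℓ + m + N : ℕ) : ℝ) - ((ℓ + m : ℕ) : ℝ)) = (N : ℝ) := by push_cast; ring
  have e4 : (((ℓ + m : ℕ) : ℝ) - (ℓ : ℝ)) = (m : ℝ) := by push_cast; ring
  rw [e1, e2, e3, e4]
  have hm' : (1 : ℝ) ≤ m := by exact_mod_cast hm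
  have hl' : (0 : ℝ) ≤ ℓ := Nat.cast_nonneg _
  have hL : 0 ≤ Real.log (N : ℝ) := Real.log_natCast_nonneg N
  have h1 : Real.log ((ℓ + m : ℕ) : ℝ) ≤ Real.log (N : ℝ) := by
    apply Real.log_le_log
    · exact_mod_cast hk
    · exact_mod_cast hN
  have key : ∀ n : ℕ, m ≤ n → n ≤ N →
      Real.log (Nat.choose n m : ℝ) ≤ m * Real.log (N : ℝ) := by
    intro n h h'
    rw [← Real.log_pow]
    apply Real.log_le_log
    · exact_mod_cast Nat.choose_pos h
    · exact_mod_cast (Nat.choose_le_pow n m).trans (Nat.pow_le_pow_left h' m)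
  have h2 := key (ℓ + m) (by omega) hN
  have h3 := key N (by omega) le_rfl
  rw [Nat.choose_symm_add.symm] at h2
  have hS : Real.log ((ℓ + m : ℕ) : ℝ) + Real.log (Nat.choose (ℓ + m) ℓ : ℝ)
      + Real.log (Nat.choose N m : ℝ) ≤ 3 * m * Real.log (N : ℝ) := by
    nlinarith
  have hs2 := sq_nonneg σ
  have hA : ((ℓ + m : ℕ) : ℝ) * (((ℓ + m : ℕ) : ℝ) + σ ^ 2) - (ℓ : ℝ) ^ 2
      ≤ m * ((ℓ + m : ℕ) : ℝ) * (2 + σ ^ 2) := by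
    push_cast
    nlinarith [mul_nonneg (mul_nonneg (sub_nonneg.2 hm') (by positivity : (0 : ℝ) ≤ ℓ + m)) hs2]
  have hA0 : 2 * π ^ 2 * (((ℓ + m : ℕ) : ℝ) * (((ℓ + m : ℕ) : ℝ) + σ ^ 2) - (ℓ : ℝ) ^ 2)
      / (m : ℝ) ^ 2 ≤ 2 * π ^ 2 * (m * ((ℓ + m : ℕ) : ℝ) * (2 + σ ^ 2)) / (m : ℝ) ^ 2 := by
    gcongr
  have hS0 : 0 ≤ Real.log ((ℓ + m : ℕ) : ℝ) + Real.log (Nat.choose (ℓ + m) ℓ : ℝ)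
      + Real.log (Nat.choose N m : ℝ) := by
    have a := Real.log_natCast_nonneg (ℓ + m)
    have b := Real.log_natCast_nonneg (Nat.choose (ℓ + m) ℓ)
    have c := Real.log_natCast_nonneg (Nat.choose N m)
    linarith
  refine (mul_le_mul hA0 hS hS0 (by positivity)).trans (le_of_eq ?_)
  have : (m : ℝ) ≠ 0 := by positivity
  field_simp
  ring
end
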